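/- Let 0 ≠ ν < 1, 1 ≤ p < ∞, δ ∈ ℝ. The exotic Bessel heat semigroup maximal operator W̃_*^ν, considered on the measure space (ℝ₊, x^δ dx), is of weak type (p,p) if and only if 2νp − 1 ≤ δ < 2p − 1, with the second inequality weakened to δ ≤ 2p − 1 in case p = 1. -/

import Mathlib

open MeasureTheory Set ENNReal
open scoped NNReal

noncomputable section

/-- The measure `x^δ dx` on `(0,∞)`. -/
def powMeasure (δ : ℝ) : Measure ℝ :=
  (volume.restrict (Ioi (0:ℝ))).withDensity (fun x => ENNReal.ofReal (x ^ δ))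

/-- `f ∈ L^p(ℝ₊, x^δ dx)` for a real exponent `p`. -/
def MemLpPow (f : ℝ → ℝ) (p δ : ℝ) : Prop :=
  AEMeasurable f (powMeasure δ) ∧
    ∫⁻ x, ENNReal.ofReal |f x| ^ p ∂(powMeasure δ) < ⊤

/-- `T` is of strong type `(p,p)` with respect to `(ℝ₊, x^δ dx)`. -/
def IsStrongType (T : (ℝ → ℝ) → (ℝ → ℝ)) (p δ : ℝ) : Prop :=
  ∃ C : ℝ≥0, ∀ f : ℝ → ℝ, MemLpPow f p δ →
    ∫⁻ x, ENNReal.ofReal |T f x| ^ p ∂(powMeasure δ) ≤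
      C * ∫⁻ x, ENNReal.ofReal |f x| ^ p ∂(powMeasure δ)

/-- `T` is of strong type `(∞,∞)`, i.e. bounded on `L^∞(ℝ₊, dx)`. -/
def IsStrongTypeInfty (T : (ℝ → ℝ) → (ℝ → ℝ)) : Prop :=
  ∃ C : ℝ≥0, ∀ f : ℝ → ℝ,
    eLpNorm (T f) ⊤ (volume.restrict (Ioi (0:ℝ))) ≤
      C * eLpNorm f ⊤ (volume.restrict (Ioi (0:ℝ)))

/-- `T` is of weak type `(p,p)` with respect to `(ℝ₊, x^δ dx)`. -/
def IsWeakType (T : (ℝ → ℝ) → (ℝ → ℝ)) (p δ : ℝ) : Prop :=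
  ∃ C : ℝ≥0, ∀ f : ℝ → ℝ, MemLpPow f p δ → ∀ l : ℝ, 0 < l →
    ENNReal.ofReal (l ^ p) * powMeasure δ {y | l < |T f y|} ≤
      C * ∫⁻ x, ENNReal.ofReal |f x| ^ p ∂(powMeasure δ)

/-- `T` is of restricted weak type `(p,p)` with respect to `(ℝ₊, x^δ dx)`:
the weak type inequality holds uniformly over indicator functions of sets of
finite `x^δ dx` measure. -/
def IsRestrictedWeakType (T : (ℝ → ℝ) → (ℝ → ℝ)) (p δ : ℝ) : Prop :=
  ∃ C : ℝ≥0, ∀ E : Set ℝ, MeasurableSet E → powMeasure δ E < ⊤ → ∀ l : ℝ, 0 < l →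
    ENNReal.ofReal (l ^ p) * powMeasure δ {y | l < |T (E.indicator 1) y|} ≤
      C * powMeasure δ E

/-- The modified Bessel function `I_μ` (for `μ > -1`, `w > 0`). -/
def besselI (μ : ℝ) (w : ℝ) : ℝ :=
  ∑' n : ℕ, (w / 2) ^ (2 * (n : ℝ) + μ) / (Real.Gamma ((n : ℝ) + 1) * Real.Gamma ((n : ℝ) + μ + 1))

/-- The classical Bessel heat kernel `W_t^ν(x,y)` (for `ν > -1`). -/
def Wcls (ν t x y : ℝ) : ℝ :=
  (2 * t)⁻¹ * (x * y) ^ (-ν) * Real.exp (-(x ^ 2 + y ^ 2) / (4 * t)) * besselI ν (x * y / (2 * t))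

/-- The exotic Bessel heat kernel `W̃_t^ν(x,y)` (for `ν < 1`). -/
def Wexo (ν t x y : ℝ) : ℝ :=
  (x * y) ^ (-(2 * ν)) * Wcls (-ν) t x y

/-- The measure `dη_ν(x) = x^{2ν+1} dx` on `(0,∞)`. -/
def etaMeasure (ν : ℝ) : Measure ℝ :=
  (volume.restrict (Ioi (0:ℝ))).withDensity (fun x => ENNReal.ofReal (x ^ (2 * ν + 1)))

/-- `W̃_t^ν f(x) = ∫₀^∞ W̃_t^ν(x,y) f(y) dη_ν(y)`. -/
def WexoInt (ν t : ℝ) (f : ℝ → ℝ) (x : ℝ) : ℝ :=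
  ∫ y, Wexo ν t x y * f y ∂(etaMeasure ν)

/-- The exotic Bessel heat semigroup maximal operator `W̃_*^ν`. -/
def WexoMax (ν : ℝ) (f : ℝ → ℝ) (x : ℝ) : ℝ≥0∞ :=
  ⨆ t ∈ Ioi (0:ℝ), ENNReal.ofReal |WexoInt ν t f x|

/-- The `n`-th term of the power series of `besselI μ w`. -/
def besselTerm (μ w : ℝ) (n : ℕ) : ℝ :=
  (w / 2) ^ (2 * (n : ℝ) + μ) / (Real.Gamma ((n : ℝ) + 1) * Real.Gamma ((n : ℝ) + μ + 1))

lemma besselTerm_pos {μ w : ℝ} (hμ : -1 < μ) (hw : 0 < w) (n : ℕ) : 0 < besselTerm μ w n := by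
  have hn : (0 : ℝ) ≤ n := n.cast_nonneg
  have h1 := Real.Gamma_pos_of_pos (show (0 : ℝ) < n + 1 by linarith)
  have h2 := Real.Gamma_pos_of_pos (show (0 : ℝ) < n + μ + 1 by linarith)
  unfold besselTerm
  positivity

lemma besselTerm_add_one {μ w : ℝ} (hμ : -1 < μ) (hw : 0 < w) (n : ℕ) :
    besselTerm (μ + 1) w n = besselTerm μ w n * ((w / 2) / (n + μ + 1)) := by
  have hn : (0 : ℝ) ≤ n := n.cast_nonneg
  have h1 := Real.Gamma_pos_of_pos (show (0 : ℝ) < n + 1 by linarith)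
  have h2 := Real.Gamma_pos_of_pos (show (0 : ℝ) < n + μ + 1 by linarith)
  have h3 : (0 : ℝ) < n + μ + 1 := by linarith
  unfold besselTerm
  rw [show (n : ℝ) + (μ + 1) + 1 = (n + μ + 1) + 1 by ring, Real.Gamma_add_one h3.ne',
    show 2 * (n : ℝ) + (μ + 1) = (2 * n + μ) + 1 by ring, Real.rpow_add_one (by positivity)]
  field_simp

lemma besselTerm_succ {μ w : ℝ} (hμ : -1 < μ) (hw : 0 < w) (n : ℕ) :
    besselTerm μ w (n + 1) = besselTerm μ w n * ((w / 2) ^ 2 / ((n + 1) * (n + μ + 1))) := by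
  have hn : (0 : ℝ) ≤ n := n.cast_nonneg
  have h1 := Real.Gamma_pos_of_pos (show (0 : ℝ) < n + 1 by linarith)
  have h2 := Real.Gamma_pos_of_pos (show (0 : ℝ) < n + μ + 1 by linarith)
  have h3 : (0 : ℝ) < n + μ + 1 := by linarith
  unfold besselTerm
  push_cast
  rw [show (n : ℝ) + 1 + μ + 1 = (n + μ + 1) + 1 by ring, Real.Gamma_add_one h3.ne',
    Real.Gamma_add_one (show (n : ℝ) + 1 ≠ 0 by positivity),
    show 2 * ((n : ℝ) + 1) + μ = (2 * n + μ) + 1 + 1 by ring, Real.rpow_add_one (by positivity),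
    Real.rpow_add_one (by positivity)]
  field_simp

lemma besselTerm_neg_half {w : ℝ} (hw : 0 < w) (n : ℕ) :
    besselTerm (-(1 / 2)) w n =
      (w / 2) ^ (-(1 / 2) : ℝ) / √Real.pi * (w ^ (2 * n) / (2 * n).factorial) := by
  have h := Real.Gamma_mul_Gamma_add_half ((n : ℝ) + 1 / 2)
  have h2 : Real.Gamma (2 * ((n : ℝ) + 1 / 2)) = (2 * n).factorial := by
    rw [← Real.Gamma_nat_eq_factorial]; push_cast; ring_nf
  rw [h2, show (1 : ℝ) - 2 * (n + 1 / 2) = -((2 * n : ℕ) : ℝ) by push_cast; ring,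
    Real.rpow_neg (by norm_num), Real.rpow_natCast] at h
  unfold besselTerm
  rw [mul_comm (Real.Gamma _), show (n : ℝ) + -(1 / 2) + 1 = n + 1 / 2 by ring,
    show (n : ℝ) + 1 = n + 1 / 2 + 1 / 2 by ring, h, Real.rpow_add (by positivity),
    show 2 * (n : ℝ) = ((2 * n : ℕ) : ℝ) by push_cast; ring, Real.rpow_natCast, div_pow]
  have : 0 < √Real.pi := Real.sqrt_pos.2 Real.pi_pos
  have := (2 * n).factorial_pos
  field_simp

lemma Gamma_add_ge {z θ : ℝ} (hz : 1 / 2 ≤ z) (h0 : 0 ≤ θ) (h1 : θ ≤ 1) :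
    z ^ θ * Real.Gamma z ≤ 3 * Real.Gamma (z + θ) := by
  have hz0 : 0 < z := by linarith
  have hG := Real.Gamma_pos_of_pos (show 0 < z + θ by linarith)
  have hGz := Real.Gamma_pos_of_pos hz0
  rcases h0.eq_or_lt with rfl | h0
  · simp; linarith
  rcases h1.eq_or_lt with rfl | h1
  · rw [Real.Gamma_add_one hz0.ne', Real.rpow_one]; nlinarith [mul_pos hz0 hGz]
  have h := Real.Gamma_mul_add_mul_le_rpow_Gamma_mul_rpow_Gamma (s := z + θ) (t := z + θ + 1)
    (a := θ) (b := 1 - θ) (by linarith) (by linarith) h0 (by linarith) (by ring)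
  rw [show θ * (z + θ) + (1 - θ) * (z + θ + 1) = z + 1 by ring, Real.Gamma_add_one hz0.ne',
    Real.Gamma_add_one (by linarith), Real.mul_rpow (by linarith) hG.le, mul_left_comm,
    ← Real.rpow_add hG, add_sub_cancel, Real.rpow_one] at h
  have h3 : (z + θ) ^ (1 - θ) ≤ 3 * z ^ (1 - θ) := by
    calc (z + θ) ^ (1 - θ) ≤ (3 * z) ^ (1 - θ) :=
          Real.rpow_le_rpow (by linarith) (by linarith) (by linarith)
      _ = 3 ^ (1 - θ) * z ^ (1 - θ) := Real.mul_rpow (by norm_num) hz0.le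
      _ ≤ 3 ^ (1 : ℝ) * z ^ (1 - θ) := by gcongr <;> linarith
      _ = _ := by rw [Real.rpow_one]
  have h4 : z = z ^ (1 - θ) * z ^ θ := by rw [← Real.rpow_add hz0]; simp
  have h5 : z ^ (1 - θ) * (z ^ θ * Real.Gamma z) ≤ z ^ (1 - θ) * (3 * Real.Gamma (z + θ)) := by
    calc _ = z * Real.Gamma z := by rw [← mul_assoc, ← h4]
      _ ≤ _ := h
      _ ≤ 3 * z ^ (1 - θ) * Real.Gamma (z + θ) := by gcongr
      _ = _ := by ring
  exact le_of_mul_le_mul_left h5 (by positivity)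

lemma besselTerm_le_of_mem_Icc {θ w : ℝ} (h0 : 0 ≤ θ) (h1 : θ ≤ 1) (hw : 0 < w) (n : ℕ) :
    besselTerm (-(1 / 2) + θ) w n ≤ 3 * ((w / 2) ^ (-(1 / 2) : ℝ) / √Real.pi) *
      (w ^ (2 * n) / (2 * n).factorial + w ^ (2 * n + 1) / (2 * n + 1).factorial) := by
  have hn : (0 : ℝ) ≤ n := n.cast_nonneg
  have hz : (0 : ℝ) < n + 1 / 2 := by linarith
  have hG := Gamma_add_ge (z := (n : ℝ) + 1 / 2) (by linarith) h0 h1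
  have hg1 := Real.Gamma_pos_of_pos (show (0 : ℝ) < n + 1 by linarith)
  have hg2 := Real.Gamma_pos_of_pos hz
  have hg3 := Real.Gamma_pos_of_pos (show (0 : ℝ) < n + 1 / 2 + θ by linarith)
  have hpos := besselTerm_pos (μ := -(1 / 2)) (by norm_num) hw n
  have key : besselTerm (-(1 / 2) + θ) w n ≤
      3 * (besselTerm (-(1 / 2)) w n * ((w / 2) / (n + 1 / 2)) ^ θ) := by
    unfold besselTerm
    rw [show (n : ℝ) + (-(1 / 2) + θ) + 1 = n + 1 / 2 + θ by ring,
      show (n : ℝ) + -(1 / 2) + 1 = n + 1 / 2 by ring, ← add_assoc, Real.rpow_add (by positivity),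
      Real.div_rpow (by positivity) hz.le]
    rw [div_mul_div_comm, ← mul_div_assoc, div_le_div_iff₀ (by positivity) (by positivity)]
    calc _ = (w / 2) ^ (2 * (n : ℝ) + -(1 / 2)) * (w / 2) ^ θ * Real.Gamma (n + 1) *
          (((n : ℝ) + 1 / 2) ^ θ * Real.Gamma (n + 1 / 2)) := by ring
      _ ≤ (w / 2) ^ (2 * (n : ℝ) + -(1 / 2)) * (w / 2) ^ θ * Real.Gamma (n + 1) *
          (3 * Real.Gamma (n + 1 / 2 + θ)) := by gcongr
      _ = _ := by ring
  have hu : ((w / 2) / (n + 1 / 2)) ^ θ ≤ 1 + (w / 2) / (n + 1 / 2) := by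
    set u := (w / 2) / ((n : ℝ) + 1 / 2) with hu
    have hu0 : 0 < u := by positivity
    rcases le_total u 1 with h | h
    · have := Real.rpow_le_one hu0.le h h0
      linarith
    · have := Real.rpow_le_rpow_of_exponent_le h h1
      rw [Real.rpow_one] at this
      linarith
  refine key.trans ?_
  calc _ ≤ 3 * (besselTerm (-(1 / 2)) w n * (1 + (w / 2) / (n + 1 / 2))) := by gcongr
    _ = _ := by
      rw [besselTerm_neg_half hw, Nat.factorial_succ, pow_succ]
      push_cast
      have := (2 * n).factorial_pos
      field_simp

lemma hasSum_exp_pairs (w : ℝ) :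
    HasSum (fun n : ℕ => w ^ (2 * n) / ((2 * n).factorial : ℝ) +
      w ^ (2 * n + 1) / ((2 * n + 1).factorial : ℝ)) (Real.exp w) := by
  rw [← Real.cosh_add_sinh]
  exact (Real.hasSum_cosh w).add (Real.hasSum_sinh w)

/-- The bound `I_μ(w) ≲ w^(-1/2) e^w` for `w ≥ 1`, together with convergence of the series. -/
def BesselBound (μ : ℝ) : Prop :=
  ∃ C : ℝ, 0 ≤ C ∧ ∀ w : ℝ, 1 ≤ w → Summable (besselTerm μ w) ∧
    ∑' n, besselTerm μ w n ≤ C * (w ^ (-(1 / 2) : ℝ) * Real.exp w)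

lemma besselBound_of_mem_Icc {θ : ℝ} (h0 : 0 ≤ θ) (h1 : θ ≤ 1) : BesselBound (-(1 / 2) + θ) := by
  refine ⟨3 * ((1 / 2) ^ (-(1 / 2) : ℝ) / √Real.pi), by positivity, fun w hw => ?_⟩
  have hw0 : 0 < w := by linarith
  have hs := (hasSum_exp_pairs w).mul_left (3 * ((w / 2) ^ (-(1 / 2) : ℝ) / √Real.pi))
  have hle := besselTerm_le_of_mem_Icc h0 h1 hw0
  have hS : Summable (besselTerm (-(1 / 2) + θ) w) :=
    Summable.of_nonneg_of_le (fun n => (besselTerm_pos (by linarith) hw0 n).le) hle hs.summable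
  refine ⟨hS, (hS.tsum_le_tsum hle hs.summable).trans_eq ?_⟩
  rw [hs.tsum_eq, show w / 2 = w * (1 / 2) by ring, Real.mul_rpow hw0.le (by norm_num)]
  ring

lemma BesselBound.add_one {μ : ℝ} (hμ : -1 < μ) (h : BesselBound μ) : BesselBound (μ + 1) := by
  obtain ⟨C, hC, h⟩ := h
  set D : ℝ := 1 + 1 / (μ + 1) with hD
  have hμ1 : 0 < μ + 1 := by linarith
  refine ⟨2 * D * C, by positivity, fun w hw => ?_⟩
  obtain ⟨hs, hle⟩ := h w hw
  have hw0 : 0 < w := by linarith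
  have hs' : Summable (fun n => besselTerm μ w (n + 1)) := (summable_nat_add_iff 1).2 hs
  have hterm : ∀ n, besselTerm (μ + 1) w n ≤ D * (besselTerm μ w n + besselTerm μ w (n + 1)) := by
    intro n
    have hn : (0 : ℝ) ≤ n := n.cast_nonneg
    have hp := besselTerm_pos hμ hw0 n
    rw [besselTerm_add_one hμ hw0, besselTerm_succ hμ hw0]
    have h3 : (0 : ℝ) < n + μ + 1 := by linarith
    have key : (w / 2) / (n + μ + 1) ≤ D * (1 + (w / 2) ^ 2 / ((n + 1) * (n + μ + 1))) := by
      set v := (w / 2) / ((n : ℝ) + μ + 1) with hv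
      have hv0 : 0 < v := by positivity
      have e : (w / 2) ^ 2 / (((n : ℝ) + 1) * (n + μ + 1)) = v ^ 2 * ((n + μ + 1) / (n + 1)) := by
        rw [hv]; field_simp
      have hq : 1 ≤ D * ((n + μ + 1) / ((n : ℝ) + 1)) := by
        rw [hD, ← mul_div_assoc, le_div_iff₀ (by positivity)]
        have : 1 / (μ + 1) * (n + μ + 1) = n / (μ + 1) + 1 := by field_simp; ring
        have h4 : 0 ≤ (n : ℝ) / (μ + 1) := by positivity
        nlinarith
      have hD1 : 1 ≤ D := by
        have : 0 < 1 / (μ + 1) := by positivity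
        linarith
      rw [e, mul_add, mul_one, mul_left_comm]
      have := mul_le_mul_of_nonneg_left hq (sq_nonneg v)
      nlinarith [sq_nonneg (v - 1)]
    calc _ ≤ besselTerm μ w n * (D * (1 + (w / 2) ^ 2 / ((n + 1) * (n + μ + 1)))) := by gcongr
      _ = _ := by ring
  have hs2 := (hs.add hs').mul_left D
  have hS : Summable (besselTerm (μ + 1) w) :=
    Summable.of_nonneg_of_le (fun n => (besselTerm_pos (by linarith) hw0 n).le) hterm hs2
  refine ⟨hS, (hS.tsum_le_tsum hterm hs2).trans ?_⟩
  rw [tsum_mul_left, hs.tsum_add hs']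
  have h1 : ∑' n, besselTerm μ w (n + 1) ≤ ∑' n, besselTerm μ w n := by
    rw [hs.tsum_eq_zero_add]
    linarith [besselTerm_pos hμ hw0 0]
  have hD0 : 0 ≤ D := by positivity
  nlinarith [mul_le_mul_of_nonneg_left (h1.trans hle) hD0, mul_le_mul_of_nonneg_left hle hD0]

lemma BesselBound.of_add_one {μ : ℝ} (hμ : -1 < μ) (h : BesselBound (μ + 1)) :
    BesselBound μ := by
  obtain ⟨C₂, hC₂, h2⟩ := BesselBound.add_one (by linarith) h
  obtain ⟨C₁, hC₁, h1⟩ := h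
  have hμ1 : 0 < μ + 1 := by linarith
  refine ⟨2 * (μ + 1) * C₁ + C₂, by positivity, fun w hw => ?_⟩
  obtain ⟨hs1, hle1⟩ := h1 w hw
  obtain ⟨hs2, hle2⟩ := h2 w hw
  have hw0 : 0 < w := by linarith
  have h0 : besselTerm μ w 0 = 2 * (μ + 1) / w * besselTerm (μ + 1) w 0 := by
    rw [besselTerm_add_one hμ hw0]
    push_cast
    rw [zero_add]
    field_simp
  have hsucc : ∀ n, besselTerm μ w (n + 1) =
      2 * (μ + 1) / w * besselTerm (μ + 1) w (n + 1) + besselTerm (μ + 1 + 1) w n := by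
    intro n
    have hn : (0 : ℝ) ≤ n := n.cast_nonneg
    rw [besselTerm_add_one hμ hw0, besselTerm_succ hμ hw0, besselTerm_add_one (by linarith) hw0,
      besselTerm_add_one hμ hw0]
    push_cast
    have h3 : (n : ℝ) + μ + 1 ≠ 0 := (show (0 : ℝ) < n + μ + 1 by linarith).ne'
    have h4 : (n : ℝ) + 1 + μ + 1 ≠ 0 := (show (0 : ℝ) < n + 1 + μ + 1 by linarith).ne'
    have h5 : (n : ℝ) + (μ + 1) + 1 ≠ 0 := by positivity
    field_simp
    ring
  have hs1' := hs1.mul_left (2 * (μ + 1) / w)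
  have hsum' : Summable (fun n => besselTerm μ w (n + 1)) := by
    simp_rw [hsucc]
    exact ((summable_nat_add_iff 1).2 hs1').add hs2
  have hS : Summable (besselTerm μ w) := (summable_nat_add_iff 1).1 hsum'
  refine ⟨hS, ?_⟩
  have e : ∑' n, besselTerm μ w n =
      2 * (μ + 1) / w * ∑' n, besselTerm (μ + 1) w n + ∑' n, besselTerm (μ + 1 + 1) w n := by
    rw [hS.tsum_eq_zero_add, h0, ← tsum_mul_left, hs1'.tsum_eq_zero_add, add_assoc,
      ← ((summable_nat_add_iff 1).2 hs1').tsum_add hs2]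
    simp_rw [hsucc]
  rw [e, add_mul]
  refine add_le_add ?_ hle2
  have hw2 : 2 * (μ + 1) / w ≤ 2 * (μ + 1) := div_le_self (by positivity) hw
  rw [mul_assoc]
  exact mul_le_mul hw2 hle1 (tsum_nonneg fun n => (besselTerm_pos (by linarith) hw0 n).le)
    (by positivity)

lemma besselBound {μ : ℝ} (hμ : -1 < μ) : BesselBound μ := by
  have hnat : ∀ (n : ℕ) (θ : ℝ), 0 ≤ θ → θ ≤ 1 → BesselBound (-(1 / 2) + θ + n) := by
    intro n θ h0 h1
    induction n with
    | zero => simpa using besselBound_of_mem_Icc h0 h1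
    | succ n ih =>
      have : (0 : ℝ) ≤ n := n.cast_nonneg
      have := ih.add_one (by linarith)
      push_cast
      rwa [← add_assoc]
  have hge : ∀ μ : ℝ, -(1 / 2) ≤ μ → BesselBound μ := by
    intro μ h
    have h1 := Nat.floor_le (show 0 ≤ μ + 1 / 2 by linarith)
    have h2 := Nat.lt_floor_add_one (μ + 1 / 2)
    have := hnat ⌊μ + 1 / 2⌋₊ (μ + 1 / 2 - ⌊μ + 1 / 2⌋₊) (by linarith) (by linarith)
    convert this using 1
    ring
  exact (hge _ (by linarith)).of_add_one hμ

lemma besselTerm_le_of_le_one {μ w : ℝ} (hμ : -1 < μ) (hw : 0 < w) (hw1 : w ≤ 1) (n : ℕ) :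
    besselTerm μ w n ≤ w ^ μ * besselTerm μ 1 n := by
  have hn : (0 : ℝ) ≤ n := n.cast_nonneg
  have h1 := Real.Gamma_pos_of_pos (show (0 : ℝ) < n + 1 by linarith)
  have h2 := Real.Gamma_pos_of_pos (show (0 : ℝ) < n + μ + 1 by linarith)
  unfold besselTerm
  rw [← mul_div_assoc, show w / 2 = w * (1 / 2) by ring, Real.mul_rpow hw.le (by norm_num)]
  gcongr ?_ * _ / _
  exact Real.rpow_le_rpow_of_exponent_ge hw hw1 (by linarith)

lemma summable_besselTerm {μ w : ℝ} (hμ : -1 < μ) (hw : 0 < w) : Summable (besselTerm μ w) := by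
  obtain ⟨C, -, h⟩ := besselBound hμ
  rcases le_total 1 w with h1 | h1
  · exact (h w h1).1
  · exact Summable.of_nonneg_of_le (fun n => (besselTerm_pos hμ hw n).le)
      (besselTerm_le_of_le_one hμ hw h1) ((h 1 le_rfl).1.mul_left _)

lemma besselI_nonneg {μ w : ℝ} (hμ : -1 < μ) (hw : 0 < w) : 0 ≤ besselI μ w :=
  tsum_nonneg fun n => (besselTerm_pos hμ hw n).le

lemma besselI_ge {μ w : ℝ} (hμ : -1 < μ) (hw : 0 < w) :
    (w / 2) ^ μ / Real.Gamma (μ + 1) ≤ besselI μ w := by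
  have := (summable_besselTerm hμ hw).le_tsum 0 fun n _ => (besselTerm_pos hμ hw n).le
  refine le_trans (le_of_eq ?_) this
  simp [besselTerm]

lemma exists_besselI_le {μ : ℝ} (hμ : -1 < μ) :
    ∃ C : ℝ, 0 < C ∧ (∀ w, 0 < w → w ≤ 1 → besselI μ w ≤ C * w ^ μ) ∧
      ∀ w, 1 ≤ w → besselI μ w ≤ C * (w ^ (-(1 / 2) : ℝ) * Real.exp w) := by
  obtain ⟨C, hC, h⟩ := besselBound hμ
  have h1 := besselI_nonneg hμ one_pos
  refine ⟨C + besselI μ 1 + 1, by positivity, fun w hw hw1 => ?_, fun w hw => ?_⟩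
  · have := (summable_besselTerm hμ hw).tsum_le_tsum (besselTerm_le_of_le_one hμ hw hw1)
      ((summable_besselTerm hμ one_pos).mul_left _)
    rw [tsum_mul_left] at this
    change besselI μ w ≤ w ^ μ * besselI μ 1 at this
    have : 0 < w ^ μ := by positivity
    nlinarith
  · refine (h w hw).2.trans ?_
    gcongr
    linarith

lemma measurable_besselI (μ : ℝ) (hμ : -1 < μ) : Measurable ((Ioi 0).indicator (besselI μ)) := by
  refine measurable_of_tendsto_metrizable
    (f := fun N => (Ioi 0).indicator fun w => ∑ n ∈ Finset.range N, besselTerm μ w n) ?_ ?_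
  · intro N
    refine Measurable.indicator ?_ measurableSet_Ioi
    unfold besselTerm
    fun_prop
  · rw [tendsto_pi_nhds]
    intro w
    by_cases hw : w ∈ Ioi (0 : ℝ)
    · simp only [indicator_of_mem hw]
      exact (summable_besselTerm hμ hw).hasSum.tendsto_sum_nat
    · simp [indicator_of_notMem hw]

/-- The density `W̃_t^ν(x,y) y^(2ν+1)` of the exotic kernel with respect to Lebesgue measure,
written in terms of `α = -ν`. -/
def heatDensity (α t x y : ℝ) : ℝ :=
  (2 * t)⁻¹ * (x ^ α * y ^ (1 - α)) * Real.exp (-(x ^ 2 + y ^ 2) / (4 * t)) *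
    besselI α (x * y / (2 * t))

lemma Wexo_mul_rpow (ν t : ℝ) {x y : ℝ} (hx : 0 < x) (hy : 0 < y) :
    Wexo ν t x y * y ^ (2 * ν + 1) = heatDensity (-ν) t x y := by
  unfold Wexo Wcls heatDensity
  rw [Real.mul_rpow hx.le hy.le, Real.mul_rpow hx.le hy.le]
  have e1 : x ^ (-ν) = x ^ (-(2 * ν)) * x ^ (- -ν) := by
    rw [← Real.rpow_add hx]; ring_nf
  have e2 : y ^ (1 - -ν) = y ^ (-(2 * ν)) * y ^ (- -ν) * y ^ (2 * ν + 1) := by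
    rw [← Real.rpow_add hy, ← Real.rpow_add hy]; ring_nf
  rw [e1, e2]
  ring

lemma heatDensity_nonneg {α t x y : ℝ} (hα : -1 < α) (ht : 0 < t) (hx : 0 < x) (hy : 0 < y) :
    0 ≤ heatDensity α t x y := by
  have := besselI_nonneg hα (show 0 < x * y / (2 * t) by positivity)
  unfold heatDensity
  positivity

lemma exp_heat_eq {t : ℝ} (ht : 0 < t) (x y : ℝ) :
    Real.exp (-(x ^ 2 + y ^ 2) / (4 * t)) * Real.exp (x * y / (2 * t)) =
      Real.exp (-(x - y) ^ 2 / (4 * t)) := by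
  rw [← Real.exp_add]
  congr 1
  field_simp
  ring

lemma rpow_heat_eq {α t x y : ℝ} (ht : 0 < t) (hx : 0 < x) (hy : 0 < y) :
    (2 * t)⁻¹ * (x ^ α * y ^ (1 - α)) * (x * y / (2 * t)) ^ α =
      2 ^ (-1 - α) * (t ^ (-1 - α) * x ^ (2 * α) * y) := by
  rw [Real.div_rpow (by positivity) (by positivity), Real.mul_rpow hx.le hy.le,
    Real.mul_rpow two_pos.le ht.le]
  have e1 : x ^ (2 * α) = x ^ α * x ^ α := by rw [← Real.rpow_add hx]; ring_nf
  have e2 : y = y ^ (1 - α) * y ^ α := by rw [← Real.rpow_add hy]; simp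
  have e3 : t ^ (-1 - α) = t⁻¹ * (t ^ α)⁻¹ := by
    rw [← Real.rpow_neg ht.le, ← Real.rpow_neg_one t, ← Real.rpow_add ht]; ring_nf
  have e4 : (2 : ℝ) ^ (-1 - α) = 2⁻¹ * (2 ^ α)⁻¹ := by
    rw [← Real.rpow_neg two_pos.le, ← Real.rpow_neg_one 2, ← Real.rpow_add two_pos]; ring_nf
  rw [e1, e3, e4]
  nth_rewrite 3 [e2]
  field_simp

lemma exists_heatDensity_le {α : ℝ} (hα : -1 < α) :
    ∃ C : ℝ, 0 < C ∧ ∀ t x y : ℝ, 0 < t → 0 < x → 0 < y →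
      heatDensity α t x y ≤ C * (t ^ (-1 - α) * x ^ (2 * α) * y) * (1 + x * y / (2 * t)) *
        Real.exp (-(x - y) ^ 2 / (4 * t)) := by
  obtain ⟨C, hC, h1, h2⟩ := exists_besselI_le hα
  have hI : ∀ w, 0 < w → besselI α w ≤ C * (w ^ α * (1 + w) * Real.exp w) := by
    intro w hw
    rcases le_total w 1 with h | h
    · refine (h1 w hw h).trans ?_
      gcongr
      rw [mul_assoc]
      refine le_mul_of_one_le_right (by positivity) ?_
      exact one_le_mul_of_one_le_of_one_le (by linarith) (Real.one_le_exp hw.le)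
    · refine (h2 w h).trans ?_
      gcongr
      calc w ^ (-(1 / 2) : ℝ) ≤ w ^ (α + 1) := Real.rpow_le_rpow_of_exponent_le h (by linarith)
        _ = w ^ α * w := by rw [Real.rpow_add_one hw.ne']
        _ ≤ _ := by gcongr; linarith
  refine ⟨C * 2 ^ (-1 - α), by positivity, fun t x y ht hx hy => ?_⟩
  unfold heatDensity
  have hw : 0 < x * y / (2 * t) := by positivity
  calc _ ≤ (2 * t)⁻¹ * (x ^ α * y ^ (1 - α)) * Real.exp (-(x ^ 2 + y ^ 2) / (4 * t)) *
        (C * ((x * y / (2 * t)) ^ α * (1 + x * y / (2 * t)) * Real.exp (x * y / (2 * t)))) := by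
        gcongr; exact hI _ hw
    _ = C * ((2 * t)⁻¹ * (x ^ α * y ^ (1 - α)) * (x * y / (2 * t)) ^ α) *
        (1 + x * y / (2 * t)) * (Real.exp (-(x ^ 2 + y ^ 2) / (4 * t)) *
          Real.exp (x * y / (2 * t))) := by ring
    _ = _ := by rw [exp_heat_eq ht, rpow_heat_eq ht hx hy]; ring

lemma heatDensity_ge {α t x y : ℝ} (hα : -1 < α) (ht : 0 < t) (hx : 0 < x) (hy : 0 < y) :
    2 ^ (-1 - 2 * α) / Real.Gamma (α + 1) * (t ^ (-1 - α) * x ^ (2 * α) * y) *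
      Real.exp (-(x ^ 2 + y ^ 2) / (4 * t)) ≤ heatDensity α t x y := by
  have hw : 0 < x * y / (2 * t) := by positivity
  have h := besselI_ge hα hw
  have e : (2 : ℝ) ^ (-1 - 2 * α) = 2 ^ (-1 - α) * (2 ^ α)⁻¹ := by
    rw [← Real.rpow_neg two_pos.le, ← Real.rpow_add two_pos]; ring_nf
  unfold heatDensity
  calc _ = (2 ^ (-1 - α) * (t ^ (-1 - α) * x ^ (2 * α) * y)) *
        Real.exp (-(x ^ 2 + y ^ 2) / (4 * t)) * ((2 ^ α)⁻¹ / Real.Gamma (α + 1)) := by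
        rw [e]; ring
    _ = (2 * t)⁻¹ * (x ^ α * y ^ (1 - α)) * Real.exp (-(x ^ 2 + y ^ 2) / (4 * t)) *
        ((x * y / (2 * t) / 2) ^ α / Real.Gamma (α + 1)) := by
        rw [← rpow_heat_eq ht hx hy, Real.div_rpow hw.le two_pos.le]; ring
    _ ≤ _ := by gcongr

lemma rpow_le_mul_exp {β c s : ℝ} (hβ : 0 < β) (hc : 0 < c) (hs : 0 < s) :
    s ^ β * Real.exp (-(c * s)) ≤ (β / c) ^ β := by
  have h1 : s * c / β ≤ Real.exp (s * c / β) := by linarith [Real.add_one_le_exp (s * c / β)]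
  have h2 := Real.rpow_le_rpow (by positivity) h1 hβ.le
  rw [← Real.exp_mul, div_mul_cancel₀ _ hβ.ne'] at h2
  have e : s ^ β = (β / c) ^ β * (s * c / β) ^ β := by
    rw [← Real.mul_rpow (by positivity) (by positivity)]
    congr 1
    field_simp
  rw [e, Real.exp_neg, ← div_eq_mul_inv, div_le_iff₀ (Real.exp_pos _), mul_comm c s]
  gcongr

lemma exists_heatDensity_far_le {α : ℝ} (hα : -1 < α) :
    ∃ C c : ℝ, 0 < C ∧ 0 < c ∧ ∀ t x y M : ℝ, 0 < t → 0 < x → 0 < y → x ≤ M → y ≤ M →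
      M ≤ 21 * |x - y| →
      heatDensity α t x y ≤ C * (t ^ (-1 - α) * x ^ (2 * α) * y) *
        Real.exp (-(c * (M ^ 2 / t))) := by
  obtain ⟨C, hC, h⟩ := exists_heatDensity_le hα
  refine ⟨C * 1764, 1 / 3528, by positivity, by positivity, fun t x y M ht hx hy hxM hyM hM => ?_⟩
  refine (h t x y ht hx hy).trans ?_
  have hM0 : 0 < M := by linarith
  have h1 : 1 + x * y / (2 * t) ≤ 1764 * Real.exp (1 / 3528 * (M ^ 2 / t)) := by
    have h3 := Real.add_one_le_exp (1 / 3528 * (M ^ 2 / t))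
    have h4 : x * y / (2 * t) ≤ 1 / 2 * (M ^ 2 / t) := by
      rw [div_mul_div_comm, one_mul]
      gcongr
      nlinarith
    have h5 : 0 < M ^ 2 / t := by positivity
    linarith
  have h2 : Real.exp (-(x - y) ^ 2 / (4 * t)) ≤ Real.exp (-(1 / 1764 * (M ^ 2 / t))) := by
    rw [Real.exp_le_exp, neg_div, neg_le_neg_iff, div_mul_div_comm, one_mul,
      div_le_div_iff₀ (by positivity) (by positivity)]
    have : M ^ 2 ≤ 441 * (x - y) ^ 2 := by
      rw [← sq_abs (x - y)]; nlinarith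
    nlinarith
  calc _ ≤ C * (t ^ (-1 - α) * x ^ (2 * α) * y) * (1764 * Real.exp (1 / 3528 * (M ^ 2 / t))) *
        Real.exp (-(1 / 1764 * (M ^ 2 / t))) := by gcongr
    _ = C * 1764 * (t ^ (-1 - α) * x ^ (2 * α) * y) * (Real.exp (1 / 3528 * (M ^ 2 / t)) *
        Real.exp (-(1 / 1764 * (M ^ 2 / t)))) := by ring
    _ = _ := by rw [← Real.exp_add]; ring_nf

lemma rpow_time_eq {α t M : ℝ} (ht : 0 < t) (hM : 0 < M) :
    t ^ (-1 - α) = M ^ (-2 - 2 * α) * (M ^ 2 / t) ^ (1 + α) := by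
  rw [Real.div_rpow (by positivity) ht.le, ← Real.rpow_natCast M 2, ← Real.rpow_mul hM.le,
    div_eq_mul_inv, ← Real.rpow_neg ht.le, ← mul_assoc, ← Real.rpow_add hM]
  have : -2 - 2 * α + ((2 : ℕ) : ℝ) * (1 + α) = 0 := by push_cast; ring
  rw [this, Real.rpow_zero, one_mul]
  ring_nf

lemma exists_heatDensity_le_of_lt {α : ℝ} (hα : -1 < α) :
    ∃ C : ℝ, 0 < C ∧ ∀ t x y : ℝ, 0 < t → 0 < x → 0 < y → y ≤ x - x / 20 →
      heatDensity α t x y ≤ C * (x ^ (-2 : ℝ) * y) := by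
  obtain ⟨C, c, hC, hc, h⟩ := exists_heatDensity_far_le hα
  have hβ : 0 < 1 + α := by linarith
  refine ⟨C * ((1 + α) / c) ^ (1 + α), by positivity, fun t x y ht hx hy hxy => ?_⟩
  refine (h t x y x ht hx hy le_rfl (by linarith) ?_).trans ?_
  · rw [abs_of_nonneg (by linarith)]; linarith
  have h1 := rpow_le_mul_exp hβ hc (show 0 < x ^ 2 / t by positivity)
  rw [rpow_time_eq ht hx]
  have e : x ^ (-2 : ℝ) = x ^ (-2 - 2 * α) * x ^ (2 * α) := by
    rw [← Real.rpow_add hx]; ring_nf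
  calc _ = C * (x ^ (-2 : ℝ) * y) *
        ((x ^ 2 / t) ^ (1 + α) * Real.exp (-(c * (x ^ 2 / t)))) := by rw [e]; ring
    _ ≤ C * (x ^ (-2 : ℝ) * y) * ((1 + α) / c) ^ (1 + α) := by gcongr
    _ = _ := by ring

lemma exists_heatDensity_le_of_gt {α : ℝ} (hα : -1 < α) :
    ∃ C c : ℝ, 0 < C ∧ 0 < c ∧ ∀ t x y : ℝ, 0 < t → 0 < x → x + x / 20 ≤ y →
      heatDensity α t x y ≤ C * (t ^ (-1 - α) * x ^ (2 * α) * y) *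
        Real.exp (-(c * (y ^ 2 / t))) := by
  obtain ⟨C, c, hC, hc, h⟩ := exists_heatDensity_far_le hα
  refine ⟨C, c, hC, hc, fun t x y ht hx hxy => ?_⟩
  refine h t x y y ht hx (by linarith) (by linarith) le_rfl ?_
  rw [abs_of_nonpos (by linarith)]; linarith

lemma exists_heatDensity_le_of_gt' {α : ℝ} (hα : -1 < α) :
    ∃ C : ℝ, 0 < C ∧ ∀ t x y : ℝ, 0 < t → 0 < x → x + x / 20 ≤ y →
      heatDensity α t x y ≤ C * (x ^ (2 * α) * y ^ (-1 - 2 * α)) := by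
  obtain ⟨C, c, hC, hc, h⟩ := exists_heatDensity_le_of_gt hα
  have hβ : 0 < 1 + α := by linarith
  refine ⟨C * ((1 + α) / c) ^ (1 + α), by positivity, fun t x y ht hx hxy => ?_⟩
  have hy : 0 < y := by linarith
  refine (h t x y ht hx hxy).trans ?_
  have h1 := rpow_le_mul_exp hβ hc (show 0 < y ^ 2 / t by positivity)
  rw [rpow_time_eq ht hy]
  have e : y ^ (-1 - 2 * α) = y ^ (-2 - 2 * α) * y := by
    rw [← Real.rpow_add_one hy.ne']; ring_nf
  calc _ = C * (x ^ (2 * α) * y ^ (-1 - 2 * α)) *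
        ((y ^ 2 / t) ^ (1 + α) * Real.exp (-(c * (y ^ 2 / t)))) := by rw [e]; ring
    _ ≤ C * (x ^ (2 * α) * y ^ (-1 - 2 * α)) * ((1 + α) / c) ^ (1 + α) := by gcongr
    _ = _ := by ring

lemma rpow_le_two_rpow_abs {r a : ℝ} (h1 : 1 / 2 ≤ r) (h2 : r ≤ 2) : r ^ a ≤ 2 ^ |a| := by
  have hr : 0 < r := by linarith
  rcases le_total 0 a with h | h
  · rw [abs_of_nonneg h]
    exact Real.rpow_le_rpow hr.le h2 h
  · rw [abs_of_nonpos h, Real.rpow_neg two_pos.le, ← Real.inv_rpow two_pos.le]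
    exact Real.rpow_le_rpow_of_nonpos (by norm_num) (by linarith) h

lemma exists_heatDensity_local_le {α : ℝ} (hα : -1 < α) :
    ∃ C : ℝ, 0 < C ∧ ∀ t x y : ℝ, 0 < t → 0 < x → |y - x| < x / 20 →
      heatDensity α t x y ≤
        C * (t ^ (-(1 / 2) : ℝ) * Real.exp (-(y - x) ^ 2 / (4 * t)) + x⁻¹) := by
  obtain ⟨C₁, hC₁, -, h1⟩ := exists_besselI_le hα
  obtain ⟨C₂, hC₂, h2⟩ := exists_heatDensity_le hα
  refine ⟨C₁ * 2 ^ |1 - α| + C₂ * 4 * 4 ^ (1 + α), by positivity, fun t x y ht hx hxy => ?_⟩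
  obtain ⟨hl, hr⟩ := abs_lt.1 hxy
  have hy : 0 < y := by linarith
  have hD : x ^ α * y ^ (1 - α) ≤ x * 2 ^ |1 - α| := by
    have := rpow_le_two_rpow_abs (r := y / x) (a := 1 - α)
      (by rw [le_div_iff₀ hx]; linarith) (by rw [div_le_iff₀ hx]; linarith)
    rw [Real.div_rpow hy.le hx.le, div_le_iff₀ (by positivity)] at this
    calc _ ≤ x ^ α * (2 ^ |1 - α| * x ^ (1 - α)) := by gcongr
      _ = (x ^ α * x ^ (1 - α)) * 2 ^ |1 - α| := by ring
      _ = _ := by rw [← Real.rpow_add hx]; simp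
  have hw : 0 < x * y / (2 * t) := by positivity
  have hexp : 0 < t ^ (-(1 / 2) : ℝ) * Real.exp (-(y - x) ^ 2 / (4 * t)) := by positivity
  have hxi : 0 < x⁻¹ := by positivity
  rcases le_total 1 (x * y / (2 * t)) with h | h
  · have hw2 : (x * y / (2 * t)) ^ (-(1 / 2) : ℝ) ≤ 2 * t ^ (1 / 2 : ℝ) * x⁻¹ := by
      have e : 2 * t ^ (1 / 2 : ℝ) * x⁻¹ = ((x / 2) ^ 2 / t) ^ (-(1 / 2) : ℝ) := by
        rw [Real.div_rpow (by positivity) ht.le, ← Real.rpow_natCast (x / 2) 2,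
          ← Real.rpow_mul (by positivity)]
        norm_num
        rw [Real.rpow_neg_one, Real.rpow_neg ht.le]
        field_simp
      rw [e]
      refine Real.rpow_le_rpow_of_nonpos (by positivity) ?_ (by norm_num)
      rw [div_le_div_iff₀ (by positivity) (by positivity)]
      have : x * x / 2 ≤ x * y := by nlinarith
      nlinarith
    unfold heatDensity
    have et : t⁻¹ * t ^ (1 / 2 : ℝ) = t ^ (-(1 / 2) : ℝ) := by
      rw [← Real.rpow_neg_one, ← Real.rpow_add ht]; norm_num
    calc _ ≤ (2 * t)⁻¹ * (x * 2 ^ |1 - α|) * Real.exp (-(x ^ 2 + y ^ 2) / (4 * t)) *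
          (C₁ * (2 * t ^ (1 / 2 : ℝ) * x⁻¹ * Real.exp (x * y / (2 * t)))) := by
          gcongr
          · exact besselI_nonneg hα hw
          · refine (h1 _ h).trans ?_
            gcongr
      _ = C₁ * 2 ^ |1 - α| * (t⁻¹ * t ^ (1 / 2 : ℝ)) *
          (Real.exp (-(x ^ 2 + y ^ 2) / (4 * t)) * Real.exp (x * y / (2 * t))) := by
          field_simp
      _ = C₁ * 2 ^ |1 - α| * (t ^ (-(1 / 2) : ℝ) * Real.exp (-(y - x) ^ 2 / (4 * t))) := by
          rw [exp_heat_eq ht, et, show (x - y) ^ 2 = (y - x) ^ 2 by ring]; ring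
      _ ≤ _ := by
          gcongr ?_ * ?_
          · have : 0 < C₂ * 4 * 4 ^ (1 + α) := by positivity
            linarith
          · linarith
  · have ht2 : t ^ (-1 - α) ≤ 4 ^ (1 + α) * x ^ (-2 - 2 * α) := by
      have e : 4 ^ (1 + α) * x ^ (-2 - 2 * α) = (x ^ 2 / 4) ^ (-1 - α) := by
        rw [Real.div_rpow (by positivity) (by norm_num), ← Real.rpow_natCast x 2,
          ← Real.rpow_mul hx.le, div_eq_mul_inv, ← Real.rpow_neg (by norm_num)]
        push_cast
        ring_nf
      rw [e]
      refine Real.rpow_le_rpow_of_nonpos (by positivity) ?_ (by linarith)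
      rw [div_le_one (by positivity)] at h
      nlinarith
    have ex : x⁻¹ = x ^ (-2 - 2 * α) * x ^ (2 * α) * x := by
      rw [← Real.rpow_add hx, ← Real.rpow_add_one hx.ne', ← Real.rpow_neg_one]; ring_nf
    have he : Real.exp (-(x - y) ^ 2 / (4 * t)) ≤ 1 := by
      rw [Real.exp_le_one_iff, neg_div]
      have : 0 ≤ (x - y) ^ 2 / (4 * t) := by positivity
      linarith
    calc _ ≤ _ := h2 t x y ht hx hy
      _ ≤ C₂ * (4 ^ (1 + α) * x ^ (-2 - 2 * α) * x ^ (2 * α) * (2 * x)) * (1 + 1) * 1 := by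
          gcongr
          linarith
      _ = C₂ * 4 * 4 ^ (1 + α) * x⁻¹ := by rw [ex]; ring
      _ ≤ _ := by
          gcongr ?_ * ?_
          · have : 0 < C₁ * 2 ^ |1 - α| := by positivity
            linarith
          · linarith

lemma lintegral_rpow_le_measure_univ_mul {X : Type*} [MeasurableSpace X] (μ : Measure X)
    {G : X → ℝ≥0∞} (hG : AEMeasurable G μ) {p : ℝ} (hp : 1 ≤ p) :
    (∫⁻ x, G x ∂μ) ^ p ≤ μ univ ^ (p - 1) * ∫⁻ x, G x ^ p ∂μ := by
  rcases hp.eq_or_lt with rfl | hp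
  · simp
  have hpq := Real.HolderConjugate.conjExponent hp
  have h := ENNReal.lintegral_mul_le_Lp_mul_Lq μ hpq hG (aemeasurable_const (b := (1 : ℝ≥0∞)))
  simp only [Pi.mul_apply, mul_one, ENNReal.one_rpow, lintegral_const, one_mul] at h
  have h2 := ENNReal.rpow_le_rpow h (show 0 ≤ p by linarith)
  rw [ENNReal.mul_rpow_of_nonneg _ _ (by linarith), ← ENNReal.rpow_mul, ← ENNReal.rpow_mul,
    one_div_mul_cancel (by linarith), ENNReal.rpow_one] at h2
  rw [mul_comm]
  convert h2 using 3
  rw [Real.conjExponent]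
  field_simp

lemma lintegral_powMeasure (δ : ℝ) (f : ℝ → ℝ≥0∞) :
    ∫⁻ x, f x ∂(powMeasure δ) = ∫⁻ x in Ioi 0, ENNReal.ofReal (x ^ δ) * f x := by
  unfold powMeasure
  rw [lintegral_withDensity_eq_lintegral_mul_non_measurable _ (by fun_prop)
    (Filter.Eventually.of_forall fun x => ENNReal.ofReal_lt_top)]
  rfl

lemma lintegral_Ioo_rpow {a x : ℝ} (ha : -1 < a) (hx : 0 ≤ x) :
    ∫⁻ y in Ioo 0 x, ENNReal.ofReal (y ^ a) = ENNReal.ofReal (x ^ (a + 1) / (a + 1)) := by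
  have hi : IntegrableOn (fun y : ℝ => y ^ a) (Ioo 0 x) := by
    rw [← intervalIntegrable_iff_integrableOn_Ioo_of_le hx]
    exact intervalIntegral.intervalIntegrable_rpow' ha
  rw [← ofReal_integral_eq_lintegral_ofReal hi]
  · rw [← integral_Ioc_eq_integral_Ioo, ← intervalIntegral.integral_of_le hx,
      integral_rpow (Or.inl ha), Real.zero_rpow (by linarith), sub_zero]
  · filter_upwards [ae_restrict_mem measurableSet_Ioo] with y hy
    exact Real.rpow_nonneg hy.1.le a

lemma lintegral_Ioi_rpow {a x : ℝ} (ha : a < -1) (hx : 0 < x) :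
    ∫⁻ y in Ioi x, ENNReal.ofReal (y ^ a) = ENNReal.ofReal (x ^ (a + 1) / (-(a + 1))) := by
  have hi := integrableOn_Ioi_rpow_of_lt ha hx
  rw [← ofReal_integral_eq_lintegral_ofReal hi]
  · rw [integral_Ioi_rpow_of_lt ha hx, div_neg, neg_div]
  · filter_upwards [ae_restrict_mem measurableSet_Ioi] with y hy
    exact Real.rpow_nonneg (hx.trans hy).le a

/-- Weak type `(p,p)` with respect to `x^δ dx` for an operator acting on nonnegative functions. -/
def HasWeakTypePow (S : (ℝ → ℝ≥0∞) → ℝ → ℝ≥0∞) (p δ : ℝ) : Prop :=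
  ∃ C : ℝ≥0, ∀ F : ℝ → ℝ≥0∞, Measurable F → ∀ l : ℝ, 0 < l →
    ENNReal.ofReal (l ^ p) * powMeasure δ {x | 0 < x ∧ ENNReal.ofReal l < S F x} ≤
      C * ∫⁻ x, F x ^ p ∂(powMeasure δ)

lemma ofReal_rpow_mul_rpow {y a b : ℝ} (hy : 0 < y) :
    ENNReal.ofReal (y ^ a) * ENNReal.ofReal (y ^ b) = ENNReal.ofReal (y ^ (a + b)) := by
  rw [← ENNReal.ofReal_mul (by positivity), Real.rpow_add hy]

/-- The Schur test with power weights. -/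
lemma hasWeakTypePow_of_schur {k : ℝ → ℝ → ℝ≥0∞} (hk : Measurable (Function.uncurry k))
    {p δ s : ℝ} (hp : 1 ≤ p) (A B : ℝ≥0)
    (hA : ∀ x, 0 < x → ∫⁻ y in Ioi 0, k x y * ENNReal.ofReal (y ^ (-s)) ≤
      A * ENNReal.ofReal (x ^ (-s)))
    (hB : ∀ y, 0 < y → ∫⁻ x in Ioi 0, k x y * ENNReal.ofReal (x ^ (δ - s * (p - 1))) ≤
      B * ENNReal.ofReal (y ^ (δ - s * (p - 1)))) :
    HasWeakTypePow (fun F x => ∫⁻ y in Ioi 0, k x y * F y) p δ := by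
  refine ⟨A ^ (p - 1) * B, fun F hF l hl => ?_⟩
  have hp0 : 0 ≤ p - 1 := by linarith
  have hpp : 0 ≤ p := by linarith
  have hkx : ∀ x, Measurable (k x) := fun x => hk.comp measurable_prodMk_left
  have hky : ∀ y, Measurable fun x => k x y := fun y => hk.comp measurable_prodMk_right
  set G : ℝ → ℝ≥0∞ := fun x => (A : ℝ≥0∞) ^ (p - 1) * (ENNReal.ofReal (x ^ (-s * (p - 1))) *
    ∫⁻ y in Ioi 0, k x y * (ENNReal.ofReal (y ^ (s * (p - 1))) * F y ^ p)) with hG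
  have hkm : Measurable (Function.uncurry fun x y : ℝ =>
      k x y * (ENNReal.ofReal (y ^ (s * (p - 1))) * F y ^ p)) := by
    unfold Function.uncurry at hk ⊢
    fun_prop
  have hGm : Measurable G := by
    have := hkm.lintegral_prod_right (ν := volume.restrict (Ioi (0 : ℝ)))
    rw [hG]
    fun_prop
  have hpt : ∀ x, 0 < x → (∫⁻ y in Ioi 0, k x y * F y) ^ p ≤ G x := by
    intro x hx
    set ν := (volume.restrict (Ioi (0 : ℝ))).withDensity
      fun y => k x y * ENNReal.ofReal (y ^ (-s)) with hν
    have hm : Measurable fun y => k x y * ENNReal.ofReal (y ^ (-s)) := (hkx x).mul (by fun_prop)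
    have hm2 : Measurable fun y => F y * ENNReal.ofReal (y ^ s) := by fun_prop
    have h := lintegral_rpow_le_measure_univ_mul ν hm2.aemeasurable hp
    rw [hν, lintegral_withDensity_eq_lintegral_mul _ hm hm2,
      lintegral_withDensity_eq_lintegral_mul _ hm (hm2.pow_const p),
      withDensity_apply _ MeasurableSet.univ, Measure.restrict_univ] at h
    have e1 : ∫⁻ y in Ioi 0, k x y * F y = ∫⁻ y in Ioi 0,
        ((fun y => k x y * ENNReal.ofReal (y ^ (-s))) * fun y => F y * ENNReal.ofReal (y ^ s)) y := by
      refine setLIntegral_congr_fun measurableSet_Ioi fun y hy => ?_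
      have : ENNReal.ofReal (y ^ (-s)) * ENNReal.ofReal (y ^ s) = 1 := by
        rw [ofReal_rpow_mul_rpow hy]; simp
      calc k x y * F y = k x y * F y * (ENNReal.ofReal (y ^ (-s)) * ENNReal.ofReal (y ^ s)) := by
            rw [this, mul_one]
        _ = _ := by simp only [Pi.mul_apply]; ring
    have e2 : ∫⁻ y in Ioi 0, ((fun y => k x y * ENNReal.ofReal (y ^ (-s))) *
          fun y => (F y * ENNReal.ofReal (y ^ s)) ^ p) y =
        ∫⁻ y in Ioi 0, k x y * (ENNReal.ofReal (y ^ (s * (p - 1))) * F y ^ p) := by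
      refine setLIntegral_congr_fun measurableSet_Ioi fun y hy => ?_
      have hy0 : 0 < y := hy
      simp only [Pi.mul_apply]
      rw [ENNReal.mul_rpow_of_nonneg _ _ hpp, ENNReal.ofReal_rpow_of_pos (by positivity),
        ← Real.rpow_mul hy0.le, show s * (p - 1) = -s + s * p by ring, ← ofReal_rpow_mul_rpow hy0]
      ring
    rw [← e1, e2] at h
    refine h.trans ?_
    calc _ ≤ (A * ENNReal.ofReal (x ^ (-s))) ^ (p - 1) * _ := by
          gcongr
          exact hA x hx
      _ = _ := by
          rw [ENNReal.mul_rpow_of_nonneg _ _ hp0, ENNReal.ofReal_rpow_of_pos (by positivity),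
            ← Real.rpow_mul hx.le, hG, mul_assoc]
  have hsub : powMeasure δ {x | 0 < x ∧ ENNReal.ofReal l < ∫⁻ y in Ioi 0, k x y * F y} ≤
      powMeasure δ {x | ENNReal.ofReal (l ^ p) ≤ G x} := by
    refine measure_mono fun x hx => ?_
    refine le_trans ?_ (hpt x hx.1)
    rw [← ENNReal.ofReal_rpow_of_pos hl]
    exact ENNReal.rpow_le_rpow hx.2.le hpp
  calc _ ≤ ENNReal.ofReal (l ^ p) * powMeasure δ {x | ENNReal.ofReal (l ^ p) ≤ G x} := by gcongr
    _ ≤ ∫⁻ x, G x ∂(powMeasure δ) := mul_meas_ge_le_lintegral hGm _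
    _ = ∫⁻ x in Ioi 0, ∫⁻ y in Ioi 0, (A : ℝ≥0∞) ^ (p - 1) *
          (k x y * ENNReal.ofReal (x ^ (δ - s * (p - 1))) *
            (ENNReal.ofReal (y ^ (s * (p - 1))) * F y ^ p)) := by
        rw [lintegral_powMeasure]
        refine setLIntegral_congr_fun measurableSet_Ioi fun x hx => ?_
        have hx0 : 0 < x := hx
        have hm3 : Measurable fun y => k x y * (ENNReal.ofReal (y ^ (s * (p - 1))) * F y ^ p) :=
          hkm.comp measurable_prodMk_left
        simp only [hG]
        rw [← lintegral_const_mul _ hm3, ← lintegral_const_mul _ (by fun_prop),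
          ← lintegral_const_mul _ (by fun_prop)]
        refine lintegral_congr fun y => ?_
        rw [show δ - s * (p - 1) = δ + -s * (p - 1) by ring, ← ofReal_rpow_mul_rpow hx0]
        ring
    _ = ∫⁻ y in Ioi 0, ∫⁻ x in Ioi 0, (A : ℝ≥0∞) ^ (p - 1) *
          (k x y * ENNReal.ofReal (x ^ (δ - s * (p - 1))) *
            (ENNReal.ofReal (y ^ (s * (p - 1))) * F y ^ p)) := by
        refine lintegral_lintegral_swap (Measurable.aemeasurable ?_)
        unfold Function.uncurry at hk ⊢
        fun_prop
    _ ≤ ∫⁻ y in Ioi 0, (A : ℝ≥0∞) ^ (p - 1) * B * (ENNReal.ofReal (y ^ δ) * F y ^ p) := by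
        refine setLIntegral_mono' measurableSet_Ioi fun y hy => ?_
        have hy0 : 0 < y := hy
        have := hky y
        rw [lintegral_const_mul _ (by fun_prop), lintegral_mul_const _ (by fun_prop),
          mul_assoc ((A : ℝ≥0∞) ^ (p - 1)) (B : ℝ≥0∞)]
        refine mul_le_mul' le_rfl ?_
        calc _ ≤ B * ENNReal.ofReal (y ^ (δ - s * (p - 1))) *
              (ENNReal.ofReal (y ^ (s * (p - 1))) * F y ^ p) := mul_le_mul' (hB y hy0) le_rfl
          _ = B * (ENNReal.ofReal (y ^ (δ - s * (p - 1))) * ENNReal.ofReal (y ^ (s * (p - 1)))) *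
              F y ^ p := by ring
          _ = _ := by
            rw [ofReal_rpow_mul_rpow hy0, sub_add_cancel]; ring
    _ = _ := by
        rw [lintegral_const_mul _ (by fun_prop), lintegral_powMeasure,
          ENNReal.coe_mul, ENNReal.coe_rpow_of_nonneg _ hp0]

/-- A pointwise bound with the critical power of `x` gives a weak type estimate. -/
lemma hasWeakTypePow_of_pointwise {S : (ℝ → ℝ≥0∞) → ℝ → ℝ≥0∞} {p δ : ℝ} (hp : 1 ≤ p)
    (hδ : δ ≠ -1) {C : ℝ} (hC : 0 < C)
    (hS : ∀ F, Measurable F → ∀ x, 0 < x →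
      S F x ^ p ≤ ENNReal.ofReal (C * x ^ (-(δ + 1))) * ∫⁻ y, F y ^ p ∂(powMeasure δ)) :
    HasWeakTypePow S p δ := by
  have hδ1 : 0 < |δ + 1| := abs_pos.2 fun h => hδ (by linarith)
  refine ⟨Real.toNNReal (C / |δ + 1|), fun F hF l hl => ?_⟩
  have hp0 : 0 < p := by linarith
  set N := ∫⁻ x, F x ^ p ∂(powMeasure δ) with hN
  rcases eq_or_ne N ⊤ with hNt | hNt
  · rw [hNt, ENNReal.mul_top]
    · exact le_top
    · simpa using div_pos hC hδ1
  have hlp : 0 < l ^ p := by positivity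
  set R : ℝ := C * N.toReal / l ^ p with hR
  have hR0 : 0 ≤ R := by positivity
  have hset : ∀ x, 0 < x → ENNReal.ofReal l < S F x → x ^ (δ + 1) < R := by
    intro x hx h
    have h1 := ENNReal.rpow_lt_rpow h hp0
    rw [ENNReal.ofReal_rpow_of_pos hl] at h1
    have h2 := h1.trans_le (hS F hF x hx)
    rw [← hN, ← ENNReal.ofReal_toReal hNt, ← ENNReal.ofReal_mul (by positivity),
      ENNReal.ofReal_lt_ofReal_iff_of_nonneg hlp.le, Real.rpow_neg hx.le] at h2
    rw [hR, lt_div_iff₀ hlp]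
    have h3 : 0 < x ^ (δ + 1) := by positivity
    calc _ < x ^ (δ + 1) * (C * (x ^ (δ + 1))⁻¹ * N.toReal) := by gcongr
      _ = _ := by field_simp
  rcases hR0.eq_or_lt with h0 | hRpos
  · have : {x | 0 < x ∧ ENNReal.ofReal l < S F x} = ∅ := by
      ext x
      simp only [mem_ofPred_eq, mem_empty_iff_false, iff_false, not_and]
      intro hx h
      have := hset x hx h
      have h3 : 0 < x ^ (δ + 1) := by positivity
      linarith
    rw [this]; simp
  have hmeas : powMeasure δ {x | 0 < x ∧ ENNReal.ofReal l < S F x} ≤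
      ENNReal.ofReal (R / |δ + 1|) := by
    set a : ℝ := R ^ (δ + 1)⁻¹ with ha
    have hne : δ + 1 ≠ 0 := fun h => hδ (by linarith)
    have ha0 : 0 < a := by positivity
    have haR : a ^ (δ + 1) = R := by rw [ha, ← Real.rpow_mul hR0, inv_mul_cancel₀ hne, Real.rpow_one]
    rcases lt_or_gt_of_ne hne with hneg | hpos
    · calc _ ≤ powMeasure δ (Ioi a) := by
            refine measure_mono fun x hx => ?_
            have h := hset x hx.1 hx.2
            rw [← haR] at h
            exact (Real.rpow_lt_rpow_iff_of_neg hx.1 ha0 hneg).1 h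
        _ = ∫⁻ y in Ioi a, ENNReal.ofReal (y ^ δ) := by
            rw [powMeasure, withDensity_apply _ measurableSet_Ioi,
              Measure.restrict_restrict measurableSet_Ioi, Ioi_inter_Ioi, sup_of_le_left ha0.le]
        _ = _ := by rw [lintegral_Ioi_rpow (by linarith) ha0, haR, abs_of_neg hneg]
    · calc _ ≤ powMeasure δ (Ioo 0 a) := by
            refine measure_mono fun x hx => ⟨hx.1, ?_⟩
            have h := hset x hx.1 hx.2
            rw [← haR] at h
            exact (Real.rpow_lt_rpow_iff hx.1.le ha0.le hpos).1 h
        _ = ∫⁻ y in Ioo 0 a, ENNReal.ofReal (y ^ δ) := by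
            rw [powMeasure, withDensity_apply _ measurableSet_Ioo,
              Measure.restrict_restrict measurableSet_Ioo, inter_eq_left.2 Ioo_subset_Ioi_self]
        _ = _ := by rw [lintegral_Ioo_rpow (by linarith) ha0.le, haR, abs_of_pos hpos]
  calc _ ≤ ENNReal.ofReal (l ^ p) * ENNReal.ofReal (R / |δ + 1|) := by gcongr
    _ = ENNReal.ofReal (C / |δ + 1|) * N := by
      conv_rhs => rw [← ENNReal.ofReal_toReal hNt]
      rw [← ENNReal.ofReal_mul hlp.le, ← ENNReal.ofReal_mul (by positivity), hR]
      congr 1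
      field_simp
    _ = _ := rfl

/-- Hardy-type majorant of the part `y < x`. -/
def hardyLow (F : ℝ → ℝ≥0∞) (x : ℝ) : ℝ≥0∞ :=
  ∫⁻ y in Ioi 0, (if y < x then ENNReal.ofReal (x ^ (-2 : ℝ) * y) else 0) * F y

/-- Hardy-type majorant of the part `y > x`. -/
def hardyUp (α : ℝ) (F : ℝ → ℝ≥0∞) (x : ℝ) : ℝ≥0∞ :=
  ∫⁻ y in Ioi 0, (if x < y then ENNReal.ofReal (x ^ (2 * α) * y ^ (-1 - 2 * α)) else 0) * F y

/-- Maximal majorant of the part `y > x`. -/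
def gaussUp (α c : ℝ) (F : ℝ → ℝ≥0∞) (x : ℝ) : ℝ≥0∞ :=
  ⨆ t ∈ Ioi (0 : ℝ), ∫⁻ y in Ioi 0, ENNReal.ofReal (t ^ (-1 - α) * x ^ (2 * α) * y *
    Real.exp (-(c * (y ^ 2 / t)))) * F y

lemma setLIntegral_ite_lt (x : ℝ) (g : ℝ → ℝ≥0∞) :
    ∫⁻ y in Ioi 0, (if y < x then g y else 0) = ∫⁻ y in Ioo 0 x, g y := by
  rw [show (fun y => if y < x then g y else 0) = (Iio x).indicator g from rfl,
    lintegral_indicator measurableSet_Iio, Measure.restrict_restrict measurableSet_Iio]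
  congr 2
  ext y; simp [and_comm]

lemma setLIntegral_ite_gt {x : ℝ} (hx : 0 < x) (g : ℝ → ℝ≥0∞) :
    ∫⁻ y in Ioi 0, (if x < y then g y else 0) = ∫⁻ y in Ioi x, g y := by
  rw [show (fun y => if x < y then g y else 0) = (Ioi x).indicator g from rfl,
    lintegral_indicator measurableSet_Ioi, Measure.restrict_restrict measurableSet_Ioi,
    Ioi_inter_Ioi, sup_of_le_left hx.le]

lemma setLIntegral_Ioo_mul_rpow {a c x : ℝ} (ha : -1 < a) (hc : 0 ≤ c) (hx : 0 < x) :
    ∫⁻ y in Ioo 0 x, ENNReal.ofReal (c * y ^ a) = ENNReal.ofReal (c * (x ^ (a + 1) / (a + 1))) := by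
  simp_rw [ENNReal.ofReal_mul hc]
  rw [lintegral_const_mul _ (by fun_prop), lintegral_Ioo_rpow ha hx.le]

lemma setLIntegral_Ioi_mul_rpow {a c x : ℝ} (ha : a < -1) (hc : 0 ≤ c) (hx : 0 < x) :
    ∫⁻ y in Ioi x, ENNReal.ofReal (c * y ^ a) =
      ENNReal.ofReal (c * (x ^ (a + 1) / (-(a + 1)))) := by
  simp_rw [ENNReal.ofReal_mul hc]
  rw [lintegral_const_mul _ (by fun_prop), lintegral_Ioi_rpow ha hx]

lemma hasWeakTypePow_hardyLow {p δ : ℝ} (hp : 1 ≤ p) (h : δ < 2 * p - 1) :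
    HasWeakTypePow hardyLow p δ := by
  set ε := (2 * p - 1 - δ) / p with hε
  have hp0 : 0 < p := by linarith
  have hε0 : 0 < ε := div_pos (by linarith) hp0
  have hεp : ε * p = 2 * p - 1 - δ := by rw [hε]; field_simp
  have hk : Measurable (Function.uncurry fun x y : ℝ =>
      if y < x then ENNReal.ofReal (x ^ (-2 : ℝ) * y) else 0) := by
    unfold Function.uncurry
    refine Measurable.ite (measurableSet_lt measurable_snd measurable_fst) ?_ measurable_const
    fun_prop
  refine hasWeakTypePow_of_schur hk (s := 2 - ε) hp (Real.toNNReal (1 / ε)) (Real.toNNReal (1 / ε))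
    (fun x hx => ?_) (fun y hy => ?_)
  · simp_rw [ite_mul, zero_mul]
    rw [setLIntegral_ite_lt]
    have e : ∫⁻ y in Ioo 0 x, ENNReal.ofReal (x ^ (-2 : ℝ) * y) *
        ENNReal.ofReal (y ^ (-(2 - ε))) =
        ∫⁻ y in Ioo 0 x, ENNReal.ofReal (x ^ (-2 : ℝ) * y ^ (ε - 1)) := by
      refine setLIntegral_congr_fun measurableSet_Ioo fun y hy => ?_
      have hy0 : 0 < y := hy.1
      rw [← ENNReal.ofReal_mul (by positivity), mul_assoc]
      nth_rewrite 1 [← Real.rpow_one y]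
      rw [← Real.rpow_add hy0]
      ring_nf
    rw [e, setLIntegral_Ioo_mul_rpow (by linarith) (by positivity) hx]
    change _ ≤ ENNReal.ofReal _ * _
    rw [← ENNReal.ofReal_mul (by positivity)]
    refine (congrArg ENNReal.ofReal ?_).le
    rw [← mul_div_assoc, ← Real.rpow_add hx]
    ring_nf
  · simp_rw [ite_mul, zero_mul]
    rw [setLIntegral_ite_gt hy]
    have e : ∫⁻ x in Ioi y, ENNReal.ofReal (x ^ (-2 : ℝ) * y) *
        ENNReal.ofReal (x ^ (δ - (2 - ε) * (p - 1))) =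
        ∫⁻ x in Ioi y, ENNReal.ofReal (y * x ^ (-ε - 1)) := by
      refine setLIntegral_congr_fun measurableSet_Ioi fun x hx => ?_
      have hx0 : 0 < x := hy.trans hx
      rw [← ENNReal.ofReal_mul (by positivity), mul_comm _ y, mul_assoc, ← Real.rpow_add hx0]
      congr 3
      linear_combination hεp
    rw [e, setLIntegral_Ioi_mul_rpow (by linarith) hy.le hy]
    change _ ≤ ENNReal.ofReal _ * _
    rw [← ENNReal.ofReal_mul (by positivity)]
    refine (congrArg ENNReal.ofReal ?_).le
    rw [show -ε - 1 + 1 = δ - (2 - ε) * (p - 1) - 1 by linear_combination -hεp,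
      Real.rpow_sub_one hy.ne', show -(δ - (2 - ε) * (p - 1) - 1) = ε by linear_combination -hεp]
    field_simp

lemma hasWeakTypePow_hardyUp {α p δ : ℝ} (hp : 1 ≤ p) (h : -(2 * α * p) - 1 < δ) :
    HasWeakTypePow (hardyUp α) p δ := by
  set ε := (2 * α * p + δ + 1) / p with hε
  have hp0 : 0 < p := by linarith
  have hε0 : 0 < ε := div_pos (by linarith) hp0
  have hεp : ε * p = 2 * α * p + δ + 1 := by rw [hε]; field_simp
  have hk : Measurable (Function.uncurry fun x y : ℝ =>
      if x < y then ENNReal.ofReal (x ^ (2 * α) * y ^ (-1 - 2 * α)) else 0) := by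
    unfold Function.uncurry
    refine Measurable.ite (measurableSet_lt measurable_fst measurable_snd) ?_ measurable_const
    fun_prop
  refine hasWeakTypePow_of_schur hk (s := -2 * α + ε) hp (Real.toNNReal (1 / ε))
    (Real.toNNReal (1 / ε)) (fun x hx => ?_) (fun y hy => ?_)
  · simp_rw [ite_mul, zero_mul]
    rw [setLIntegral_ite_gt hx]
    have e : ∫⁻ y in Ioi x, ENNReal.ofReal (x ^ (2 * α) * y ^ (-1 - 2 * α)) *
        ENNReal.ofReal (y ^ (-(-2 * α + ε))) =
        ∫⁻ y in Ioi x, ENNReal.ofReal (x ^ (2 * α) * y ^ (-ε - 1)) := by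
      refine setLIntegral_congr_fun measurableSet_Ioi fun y hy => ?_
      have hy0 : 0 < y := hx.trans hy
      rw [← ENNReal.ofReal_mul (by positivity), mul_assoc, ← Real.rpow_add hy0]
      ring_nf
    rw [e, setLIntegral_Ioi_mul_rpow (by linarith) (by positivity) hx]
    change _ ≤ ENNReal.ofReal _ * _
    rw [← ENNReal.ofReal_mul (by positivity)]
    refine (congrArg ENNReal.ofReal ?_).le
    rw [← mul_div_assoc, ← Real.rpow_add hx]
    ring_nf
  · simp_rw [ite_mul, zero_mul]
    rw [setLIntegral_ite_lt]
    have e : ∫⁻ x in Ioo 0 y, ENNReal.ofReal (x ^ (2 * α) * y ^ (-1 - 2 * α)) *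
        ENNReal.ofReal (x ^ (δ - (-2 * α + ε) * (p - 1))) =
        ∫⁻ x in Ioo 0 y, ENNReal.ofReal (y ^ (-1 - 2 * α) * x ^ (ε - 1)) := by
      refine setLIntegral_congr_fun measurableSet_Ioo fun x hx => ?_
      have hx0 : 0 < x := hx.1
      rw [← ENNReal.ofReal_mul (by positivity), mul_comm _ (y ^ (-1 - 2 * α)), mul_assoc,
        ← Real.rpow_add hx0]
      congr 3
      linear_combination -hεp
    rw [e, setLIntegral_Ioo_mul_rpow (by linarith) (by positivity) hy]
    change _ ≤ ENNReal.ofReal _ * _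
    rw [← ENNReal.ofReal_mul (by positivity)]
    refine (congrArg ENNReal.ofReal ?_).le
    rw [sub_add_cancel, ← mul_div_assoc, ← Real.rpow_add hy,
      show δ - (-2 * α + ε) * (p - 1) = -1 - 2 * α + ε by linear_combination -hεp]
    ring

lemma hasWeakTypePow_hardyLow_one : HasWeakTypePow hardyLow 1 1 := by
  refine hasWeakTypePow_of_pointwise le_rfl (by norm_num) one_pos fun F hF x hx => ?_
  simp only [ENNReal.rpow_one, one_mul]
  rw [lintegral_powMeasure, ← lintegral_const_mul _ (by fun_prop), hardyLow]
  refine setLIntegral_mono' measurableSet_Ioi fun y hy => ?_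
  have hy0 : 0 < y := hy
  rw [← mul_assoc, ← ENNReal.ofReal_mul (by positivity)]
  gcongr
  split_ifs
  · norm_num
  · exact zero_le

lemma hasWeakTypePow_gaussUp {α c p δ : ℝ} (hα : -1 < α) (hα0 : α ≠ 0) (hc : 0 < c) (hp : 1 ≤ p)
    (hδ : δ = -(2 * α * p) - 1) : HasWeakTypePow (gaussUp α c) p δ := by
  have hp0 : 0 < p := by linarith
  have hα1 : 0 < 1 + α := by linarith
  have hδ1 : δ ≠ -1 := by
    intro h
    have : α * p = 0 := by linarith
    rcases mul_eq_zero.1 this with h | h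
    · exact hα0 h
    · linarith
  set A : ℝ := (1 / 2) * c ^ (-(2 + 2 * α) / 2) * Real.Gamma ((2 + 2 * α) / 2) with hA
  have hA0 : 0 < A := by
    have := Real.Gamma_pos_of_pos (show 0 < (2 + 2 * α) / 2 by linarith)
    positivity
  set B : ℝ := ((1 + α) / c) ^ (1 + α) with hB
  have hB0 : 0 < B := by positivity
  refine hasWeakTypePow_of_pointwise hp hδ1 (C := A ^ (p - 1) * B) (by positivity)
    fun F hF x hx => ?_
  rw [← ENNReal.le_rpow_inv_iff hp0]
  refine iSup₂_le fun t ht => ?_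
  have ht0 : 0 < t := ht
  rw [ENNReal.le_rpow_inv_iff hp0]
  set w : ℝ → ℝ := fun y => y ^ (1 + 2 * α) * Real.exp (-(c * (y ^ 2 / t))) with hw
  set ν := (volume.restrict (Ioi (0 : ℝ))).withDensity fun y => ENNReal.ofReal (w y) with hν
  have hwm : Measurable fun y => ENNReal.ofReal (w y) := by rw [hw]; fun_prop
  have hmass : ν univ ≤ ENNReal.ofReal (A * t ^ (1 + α)) := by
    rw [hν, withDensity_apply _ MeasurableSet.univ, Measure.restrict_univ]
    have hct : 0 < c / t := by positivity
    have hint := integral_rpow_mul_exp_neg_mul_rpow (p := 2) (q := 1 + 2 * α) (b := c / t)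
      two_pos (by linarith) hct
    have hii := integrableOn_rpow_mul_exp_neg_mul_rpow (p := 2) (s := 1 + 2 * α) (b := c / t)
      (by linarith) (by norm_num) hct
    have e : ∀ y : ℝ, w y = y ^ (1 + 2 * α) * Real.exp (-(c / t) * y ^ (2 : ℝ)) := by
      intro y
      rw [hw, Real.rpow_two]
      ring_nf
    simp_rw [e]
    rw [← ofReal_integral_eq_lintegral_ofReal hii, hint]
    · refine (congrArg ENNReal.ofReal ?_).le
      rw [hA, Real.div_rpow hc.le ht0.le, div_eq_mul_inv (c ^ _), ← Real.rpow_neg ht0.le,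
        show 1 + 2 * α + 1 = 2 + 2 * α by ring, show -(-(2 + 2 * α) / 2) = 1 + α by ring]
      ring
    · filter_upwards [ae_restrict_mem measurableSet_Ioi] with y hy
      have hy0 : 0 < y := hy
      positivity
  have hm2 : Measurable fun y => F y * ENNReal.ofReal (y ^ (-(2 * α))) := by fun_prop
  have h := lintegral_rpow_le_measure_univ_mul ν hm2.aemeasurable hp
  rw [hν, lintegral_withDensity_eq_lintegral_mul _ hwm hm2,
    lintegral_withDensity_eq_lintegral_mul _ hwm (hm2.pow_const p), ← hν] at h
  have e1 : ∫⁻ y in Ioi 0, ENNReal.ofReal (t ^ (-1 - α) * x ^ (2 * α) * y *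
      Real.exp (-(c * (y ^ 2 / t)))) * F y = ENNReal.ofReal (t ^ (-1 - α) * x ^ (2 * α)) *
      ∫⁻ y in Ioi 0, ((fun y => ENNReal.ofReal (w y)) *
        fun y => F y * ENNReal.ofReal (y ^ (-(2 * α)))) y := by
    rw [← lintegral_const_mul _ (by fun_prop)]
    refine setLIntegral_congr_fun measurableSet_Ioi fun y hy => ?_
    have hy0 : 0 < y := hy
    simp only [Pi.mul_apply, hw]
    have : y = y ^ (1 + 2 * α) * y ^ (-(2 * α)) := by
      rw [← Real.rpow_add hy0]; simp
    calc _ = ENNReal.ofReal (t ^ (-1 - α) * x ^ (2 * α) * (y ^ (1 + 2 * α) * y ^ (-(2 * α))) *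
          Real.exp (-(c * (y ^ 2 / t)))) * F y := by rw [← this]
      _ = ENNReal.ofReal ((t ^ (-1 - α) * x ^ (2 * α)) * (y ^ (1 + 2 * α) *
          Real.exp (-(c * (y ^ 2 / t)))) * y ^ (-(2 * α))) * F y := by ring_nf
      _ = _ := by
        rw [ENNReal.ofReal_mul (by positivity), ENNReal.ofReal_mul (by positivity)]
        ring
  have e2 : ∫⁻ y in Ioi 0, ((fun y => ENNReal.ofReal (w y)) *
      fun y => (F y * ENNReal.ofReal (y ^ (-(2 * α)))) ^ p) y ≤
      ENNReal.ofReal (B * t ^ (1 + α)) * ∫⁻ y, F y ^ p ∂(powMeasure δ) := by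
    rw [lintegral_powMeasure, ← lintegral_const_mul _ (by fun_prop)]
    refine setLIntegral_mono' measurableSet_Ioi fun y hy => ?_
    have hy0 : 0 < y := hy
    simp only [Pi.mul_apply]
    rw [ENNReal.mul_rpow_of_nonneg _ _ hp0.le, ENNReal.ofReal_rpow_of_pos (by positivity),
      ← Real.rpow_mul hy0.le, mul_comm (F y ^ p), ← mul_assoc, ← mul_assoc,
      ← ENNReal.ofReal_mul (by positivity), ← ENNReal.ofReal_mul (by positivity)]
    refine mul_le_mul' (ENNReal.ofReal_le_ofReal ?_) le_rfl
    have h1 := rpow_le_mul_exp hα1 hc (show 0 < y ^ 2 / t by positivity)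
    have h2 := rpow_time_eq (α := α) ht0 hy0
    have h3 : t ^ (-1 - α) * t ^ (1 + α) = 1 := by rw [← Real.rpow_add ht0]; simp
    have h4 : y ^ (1 + 2 * α) * y ^ (-(2 * α) * p) = y ^ (2 + 2 * α) * y ^ δ := by
      rw [← Real.rpow_add hy0, ← Real.rpow_add hy0, hδ]; ring_nf
    have h5 : y ^ (2 + 2 * α) * y ^ (-2 - 2 * α) = 1 := by rw [← Real.rpow_add hy0]; simp
    have h6 : (y ^ 2 / t) ^ (1 + α) * t ^ (1 + α) = y ^ (2 + 2 * α) := by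
      calc _ = (y ^ (2 + 2 * α) * y ^ (-2 - 2 * α)) * (y ^ 2 / t) ^ (1 + α) * t ^ (1 + α) := by
            rw [h5, one_mul]
        _ = y ^ (2 + 2 * α) * (t ^ (-1 - α) * t ^ (1 + α)) := by rw [h2]; ring
        _ = _ := by rw [h3, mul_one]
    calc w y * y ^ (-(2 * α) * p) = (y ^ (1 + 2 * α) * y ^ (-(2 * α) * p)) *
          Real.exp (-(c * (y ^ 2 / t))) := by rw [hw]; ring
      _ = ((y ^ 2 / t) ^ (1 + α) * Real.exp (-(c * (y ^ 2 / t)))) * t ^ (1 + α) * y ^ δ := by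
        rw [h4, ← h6]; ring
      _ ≤ B * t ^ (1 + α) * y ^ δ := by gcongr
  rw [e1, ENNReal.mul_rpow_of_nonneg _ _ hp0.le, ENNReal.ofReal_rpow_of_pos (by positivity)]
  calc _ ≤ ENNReal.ofReal ((t ^ (-1 - α) * x ^ (2 * α)) ^ p) *
        (ENNReal.ofReal (A * t ^ (1 + α)) ^ (p - 1) *
          (ENNReal.ofReal (B * t ^ (1 + α)) * ∫⁻ y, F y ^ p ∂(powMeasure δ))) := by
        gcongr
        refine h.trans ?_
        gcongr
    _ = _ := by
      rw [ENNReal.ofReal_rpow_of_pos (by positivity), ← mul_assoc, ← mul_assoc,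
        ← ENNReal.ofReal_mul (by positivity), ← ENNReal.ofReal_mul (by positivity)]
      congr 2
      have h3 : t ^ (-1 - α) * t ^ (1 + α) = 1 := by rw [← Real.rpow_add ht0]; simp
      have h4 : t ^ (1 + α) = (t ^ (-1 - α))⁻¹ := by
        rw [← Real.rpow_neg ht0.le]; ring_nf
      have h7 : x ^ (-(δ + 1)) = (x ^ (2 * α)) ^ p := by
        rw [← Real.rpow_mul hx.le, hδ]; ring_nf
      have h8 : ((t ^ (1 + α)) ^ (p - 1)) * t ^ (1 + α) = (t ^ (1 + α)) ^ p := by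
        rw [← Real.rpow_add_one (by positivity)]; ring_nf
      rw [Real.mul_rpow (by positivity) (by positivity),
        Real.mul_rpow (by positivity) (by positivity), h7]
      calc _ = A ^ (p - 1) * B * (x ^ (2 * α)) ^ p *
            ((t ^ (-1 - α)) ^ p * ((t ^ (1 + α)) ^ (p - 1) * t ^ (1 + α))) := by ring
        _ = _ := by
          rw [h8, ← Real.mul_rpow (by positivity) (by positivity), h3, Real.one_rpow, mul_one]

lemma setLIntegral_powMeasure (δ : ℝ) {s : Set ℝ} (hs : MeasurableSet s) (hs0 : s ⊆ Ioi 0)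
    (G : ℝ → ℝ≥0∞) :
    ∫⁻ y in s, G y ∂(powMeasure δ) = ∫⁻ y in s, ENNReal.ofReal (y ^ δ) * G y := by
  unfold powMeasure
  rw [restrict_withDensity hs, Measure.restrict_restrict hs, inter_eq_left.2 hs0,
    lintegral_withDensity_eq_lintegral_mul_non_measurable _ (by fun_prop)
      (Filter.Eventually.of_forall fun x => ENNReal.ofReal_lt_top)]
  rfl

lemma powMeasure_ball_le (δ : ℝ) {x r : ℝ} (hx : 0 < x) (hr : r ≤ x / 5) :
    powMeasure δ (Metric.ball x r) ≤ ENNReal.ofReal (2 ^ |δ| * x ^ δ * (2 * r)) := by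
  rw [Real.ball_eq_Ioo]
  have hs0 : Ioo (x - r) (x + r) ⊆ Ioi 0 := fun y hy => by
    have := hy.1
    simp only [mem_Ioi]
    linarith
  have h := setLIntegral_powMeasure δ (measurableSet_Ioo (a := x - r) (b := x + r)) hs0 1
  simp only [Pi.one_apply, lintegral_const, Measure.restrict_apply_univ, one_mul, mul_one] at h
  rw [h]
  calc _ ≤ ∫⁻ y in Ioo (x - r) (x + r), ENNReal.ofReal (2 ^ |δ| * x ^ δ) := by
        refine setLIntegral_mono' measurableSet_Ioo fun y hy => ENNReal.ofReal_le_ofReal ?_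
        have hy0 : 0 < y := hs0 hy
        have := rpow_le_two_rpow_abs (r := y / x) (a := δ)
          (by rw [le_div_iff₀ hx]; linarith [hy.1]) (by rw [div_le_iff₀ hx]; linarith [hy.2])
        rwa [Real.div_rpow hy0.le hx.le, div_le_iff₀ (by positivity)] at this
    _ = _ := by
        rw [setLIntegral_const, Real.volume_Ioo, ← ENNReal.ofReal_mul (by positivity)]
        ring_nf

lemma setLIntegral_ball_le (δ : ℝ) {x r : ℝ} (hx : 0 < x) (hr : r ≤ x / 5) {G : ℝ → ℝ≥0∞}
    (hG : Measurable G) :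
    ∫⁻ y in Metric.ball x r, G y ≤
      ENNReal.ofReal (2 ^ |δ| * x ^ (-δ)) * ∫⁻ y in Metric.ball x r, G y ∂(powMeasure δ) := by
  rw [Real.ball_eq_Ioo]
  have hs0 : Ioo (x - r) (x + r) ⊆ Ioi 0 := fun y hy => by
    have := hy.1
    simp only [mem_Ioi]
    linarith
  rw [setLIntegral_powMeasure δ measurableSet_Ioo hs0, ← lintegral_const_mul _ (by fun_prop)]
  refine setLIntegral_mono' measurableSet_Ioo fun y hy => ?_
  have hy0 : 0 < y := hs0 hy
  rw [← mul_assoc, ← ENNReal.ofReal_mul (by positivity)]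
  refine le_mul_of_one_le_left (zero_le) ?_
  rw [← ENNReal.ofReal_one]
  refine ENNReal.ofReal_le_ofReal ?_
  have := rpow_le_two_rpow_abs (r := y / x) (a := -δ)
    (by rw [le_div_iff₀ hx]; linarith [hy.1]) (by rw [div_le_iff₀ hx]; linarith [hy.2])
  rw [abs_neg, Real.div_rpow hy0.le hx.le, div_le_iff₀ (by positivity), Real.rpow_neg hy0.le,
    inv_le_iff_one_le_mul₀ (by positivity)] at this
  exact this

/-- Weak type `(1,1)` of the local maximal function. -/
lemma ofReal_mul_powMeasure_local_le (δ : ℝ) {G : ℝ → ℝ≥0∞} (hG : Measurable G) {a : ℝ}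
    (ha : 0 < a) :
    ENNReal.ofReal a * powMeasure δ {x | 0 < x ∧ ∃ r, 0 < r ∧ r ≤ x / 20 ∧
      ENNReal.ofReal (a * r) < ∫⁻ y in Metric.ball x r, G y} ≤
      ENNReal.ofReal (8 * (2 ^ |δ| * 2 ^ |δ|)) * ∫⁻ y, G y ∂(powMeasure δ) := by
  set t : Set ℝ := {x | 0 < x ∧ ∃ r, 0 < r ∧ r ≤ x / 20 ∧
    ENNReal.ofReal (a * r) < ∫⁻ y in Metric.ball x r, G y} with ht
  have hex : ∀ x : ℝ, ∃ r : ℝ, x ∈ t → 0 < r ∧ r ≤ x / 20 ∧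
      ENNReal.ofReal (a * r) < ∫⁻ y in Metric.ball x r, G y := by
    intro x
    by_cases hx : x ∈ t
    · obtain ⟨r, hr⟩ := hx.2
      exact ⟨r, fun _ => hr⟩
    · exact ⟨0, fun h => absurd h hx⟩
  choose r hr using hex
  obtain ⟨u, hut, hdisj, hcov⟩ := Vitali.exists_disjoint_subfamily_covering_enlargement
    (fun x => Metric.ball x (r x)) t (fun x => r x / x) 2 one_lt_two
    (fun x hx => div_nonneg (hr x hx).1.le hx.1.le) (1 / 20)
    (fun x hx => by rw [div_le_iff₀ hx.1]; linarith [(hr x hx).2.1])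
    (fun x hx => Metric.nonempty_ball.2 (hr x hx).1)
  have hu : u.Countable := hdisj.countable_of_isOpen (fun x _ => Metric.isOpen_ball)
    (fun x hx => Metric.nonempty_ball.2 (hr x (hut hx)).1)
  have hsub : t ⊆ ⋃ b ∈ u, Metric.ball b (4 * r b) := by
    intro x hx
    obtain ⟨b, hb, ⟨z, hz1, hz2⟩, hle⟩ := hcov x hx
    have hx0 := hx.1
    have hb0 := (hut hb).1
    obtain ⟨hr1, hr2, -⟩ := hr x hx
    obtain ⟨hr3, hr4, -⟩ := hr b (hut hb)
    rw [Metric.mem_ball, Real.dist_eq, abs_lt] at hz1 hz2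
    have h1 : x ≤ 21 / 19 * b := by linarith [hz1.1, hz1.2, hz2.1, hz2.2]
    have h2 : r x ≤ 42 / 19 * r b := by
      have h3 : r x ≤ 2 * (r b / b) * x := by rwa [div_le_iff₀ hx0] at hle
      calc r x ≤ 2 * (r b / b) * x := h3
        _ ≤ 2 * (r b / b) * (21 / 19 * b) := by gcongr
        _ = _ := by field_simp; norm_num
    simp only [mem_iUnion]
    refine ⟨b, hb, ?_⟩
    rw [Metric.mem_ball, Real.dist_eq, abs_lt]
    constructor <;> linarith [hz1.1, hz1.2, hz2.1, hz2.2]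
  calc _ ≤ ENNReal.ofReal a * ∑' b : u, powMeasure δ (Metric.ball (b : ℝ) (4 * r b)) := by
        gcongr
        exact (measure_mono hsub).trans (measure_biUnion_le _ hu _)
    _ = ∑' b : u, ENNReal.ofReal a * powMeasure δ (Metric.ball (b : ℝ) (4 * r b)) :=
        ENNReal.tsum_mul_left.symm
    _ ≤ ∑' b : u, ENNReal.ofReal (8 * (2 ^ |δ| * 2 ^ |δ|)) *
          ∫⁻ y in Metric.ball (b : ℝ) (r b), G y ∂(powMeasure δ) := by
        refine ENNReal.tsum_le_tsum fun b => ?_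
        have hb0 : (0 : ℝ) < b := (hut b.2).1
        obtain ⟨h1, h2, h3⟩ := hr b (hut b.2)
        have h4 : (b : ℝ) ^ δ * (b : ℝ) ^ (-δ) = 1 := by rw [← Real.rpow_add hb0]; simp
        calc _ ≤ ENNReal.ofReal a * ENNReal.ofReal (2 ^ |δ| * (b : ℝ) ^ δ * (2 * (4 * r b))) := by
              gcongr
              exact powMeasure_ball_le δ hb0 (by linarith)
          _ = ENNReal.ofReal (8 * 2 ^ |δ| * (b : ℝ) ^ δ) * ENNReal.ofReal (a * r b) := by
              rw [← ENNReal.ofReal_mul ha.le, ← ENNReal.ofReal_mul (by positivity)]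
              ring_nf
          _ ≤ ENNReal.ofReal (8 * 2 ^ |δ| * (b : ℝ) ^ δ) *
              (ENNReal.ofReal (2 ^ |δ| * (b : ℝ) ^ (-δ)) *
                ∫⁻ y in Metric.ball (b : ℝ) (r b), G y ∂(powMeasure δ)) := by
              gcongr
              exact h3.le.trans (setLIntegral_ball_le δ hb0 (by linarith) hG)
          _ = _ := by
              rw [← mul_assoc, ← ENNReal.ofReal_mul (by positivity)]
              congr 2
              linear_combination 8 * 2 ^ |δ| * 2 ^ |δ| * h4
    _ = ENNReal.ofReal (8 * (2 ^ |δ| * 2 ^ |δ|)) *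
          ∫⁻ y in ⋃ b ∈ u, Metric.ball b (r b), G y ∂(powMeasure δ) := by
        rw [ENNReal.tsum_mul_left, lintegral_biUnion hu (fun _ _ => measurableSet_ball) hdisj]
    _ ≤ _ := by
        gcongr
        exact Measure.restrict_le_self

/-- Maximal majorant of the local part `|y - x| < x / 20`. -/
def localMax (F : ℝ → ℝ≥0∞) (x : ℝ) : ℝ≥0∞ :=
  ⨆ t ∈ Ioi (0 : ℝ), ∫⁻ y in Metric.ball x (x / 20),
    ENNReal.ofReal (t ^ (-(1 / 2) : ℝ) * Real.exp (-(y - x) ^ 2 / (4 * t)) + x⁻¹) * F y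

lemma ofReal_gauss_le_tsum {t : ℝ} (ht : 0 < t) (x y : ℝ) :
    ENNReal.ofReal (t ^ (-(1 / 2) : ℝ) * Real.exp (-(y - x) ^ 2 / (4 * t))) ≤
      ∑' j : ℕ, (Metric.ball x ((j + 1) * √t)).indicator
        (fun _ => ENNReal.ofReal ((√t)⁻¹ * Real.exp (1 - j))) y := by
  have hs : 0 < √t := Real.sqrt_pos.2 ht
  have hst : √t ^ 2 = t := Real.sq_sqrt ht.le
  set j := ⌊|y - x| / √t⌋₊ with hj
  have h1 : j * √t ≤ |y - x| := by
    have := Nat.floor_le (show 0 ≤ |y - x| / √t by positivity)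
    rwa [le_div_iff₀ hs] at this
  have h2 : |y - x| < (j + 1) * √t := by
    have := Nat.lt_floor_add_one (|y - x| / √t)
    rwa [div_lt_iff₀ hs] at this
  refine le_trans ?_ (ENNReal.le_tsum j)
  rw [indicator_of_mem (by rwa [Metric.mem_ball, Real.dist_eq])]
  refine ENNReal.ofReal_le_ofReal ?_
  have h3 : t ^ (-(1 / 2) : ℝ) = (√t)⁻¹ := by
    rw [Real.rpow_neg ht.le, Real.sqrt_eq_rpow]
  rw [h3]
  gcongr
  have h4 : (j : ℝ) ^ 2 * t ≤ (y - x) ^ 2 := by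
    rw [← sq_abs (y - x), ← hst, ← mul_pow]
    gcongr
  rw [div_le_iff₀ (by positivity)]
  nlinarith [sq_nonneg ((j : ℝ) - 2)]

lemma exists_localMax_le : ∃ C : ℝ, 0 < C ∧ ∀ F : ℝ → ℝ≥0∞, Measurable F → ∀ x, 0 < x →
    ∀ A : ℝ≥0∞, (∀ r, 0 < r → r ≤ x / 20 →
      ∫⁻ y in Metric.ball x r, F y ≤ ENNReal.ofReal r * A) →
    localMax F x ≤ ENNReal.ofReal C * A := by
  have hsum : Summable fun j : ℕ => ((j : ℝ) + 1) * Real.exp (1 - j) := by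
    have h1 := Real.summable_pow_mul_exp_neg_nat_mul 1 one_pos
    have h0 := Real.summable_pow_mul_exp_neg_nat_mul 0 one_pos
    refine ((h1.add h0).mul_left (Real.exp 1)).congr fun j => ?_
    rw [sub_eq_add_neg, Real.exp_add]
    simp
    ring
  refine ⟨∑' j : ℕ, ((j : ℝ) + 1) * Real.exp (1 - j) + 1, by positivity,
    fun F hF x hx A hA => iSup₂_le fun t ht => ?_⟩
  have ht0 : 0 < t := ht
  have hs : 0 < √t := Real.sqrt_pos.2 ht0
  have hR := hA (x / 20) (by positivity) le_rfl
  calc _ ≤ ∫⁻ y in Metric.ball x (x / 20), ((∑' j : ℕ, (Metric.ball x ((j + 1) * √t)).indicator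
        (fun y => ENNReal.ofReal ((√t)⁻¹ * Real.exp (1 - j)) * F y) y) +
          ENNReal.ofReal x⁻¹ * F y) := by
        refine lintegral_mono fun y => ?_
        rw [ENNReal.ofReal_add (by positivity) (by positivity), add_mul]
        gcongr
        simp_rw [indicator_mul_left]
        rw [ENNReal.tsum_mul_right]
        gcongr
        exact ofReal_gauss_le_tsum ht0 x y
    _ = (∑' j : ℕ, ENNReal.ofReal ((√t)⁻¹ * Real.exp (1 - j)) *
          ∫⁻ y in Metric.ball x (min ((j + 1) * √t) (x / 20)), F y) +
          ENNReal.ofReal x⁻¹ * ∫⁻ y in Metric.ball x (x / 20), F y := by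
        rw [lintegral_add_right _ (by fun_prop), lintegral_const_mul _ hF, lintegral_tsum]
        · congr 2
          ext j
          rw [lintegral_indicator measurableSet_ball,
            Measure.restrict_restrict measurableSet_ball, lintegral_const_mul _ hF]
          congr 3
          ext y
          simp
        · intro j
          exact ((hF.const_mul _).indicator measurableSet_ball).aemeasurable
    _ ≤ (∑' j : ℕ, ENNReal.ofReal (((j : ℝ) + 1) * Real.exp (1 - j)) * A) + 1 * A := by
        refine add_le_add (ENNReal.tsum_le_tsum fun j => ?_) ?_
        · calc _ ≤ ENNReal.ofReal ((√t)⁻¹ * Real.exp (1 - j)) *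
              (ENNReal.ofReal ((j + 1) * √t) * A) := by
                gcongr
                refine (hA _ (by positivity) (min_le_right _ _)).trans ?_
                gcongr
                exact min_le_left _ _
            _ = _ := by
                rw [← mul_assoc, ← ENNReal.ofReal_mul (by positivity)]
                congr 2
                field_simp
        · calc _ ≤ ENNReal.ofReal x⁻¹ * (ENNReal.ofReal (x / 20) * A) := by gcongr
            _ ≤ _ := by
              rw [← mul_assoc, ← ENNReal.ofReal_mul (by positivity)]
              gcongr
              rw [ENNReal.ofReal_le_one]
              field_simp
              norm_num
    _ = _ := by
        rw [ENNReal.tsum_mul_right, ← ENNReal.ofReal_tsum_of_nonneg (fun j => by positivity) hsum,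
          ENNReal.ofReal_add (tsum_nonneg fun j => by positivity) zero_le_one, ENNReal.ofReal_one,
          add_mul]

lemma hasWeakTypePow_localMax {p : ℝ} (hp : 1 ≤ p) (δ : ℝ) : HasWeakTypePow localMax p δ := by
  obtain ⟨C, hC, hloc⟩ := exists_localMax_le
  have hp0 : 0 < p := by linarith
  refine ⟨Real.toNNReal (2 ^ (p - 1) * C ^ p * (8 * (2 ^ |δ| * 2 ^ |δ|))), fun F hF l hl => ?_⟩
  set a : ℝ := (l / C) ^ p / 2 ^ (p - 1) with ha
  have ha0 : 0 < a := by positivity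
  have hsub : {x | 0 < x ∧ ENNReal.ofReal l < localMax F x} ⊆
      {x | 0 < x ∧ ∃ r, 0 < r ∧ r ≤ x / 20 ∧
        ENNReal.ofReal (a * r) < ∫⁻ y in Metric.ball x r, F y ^ p} := by
    rintro x ⟨hx, hlt⟩
    refine ⟨hx, ?_⟩
    by_contra! hcon
    refine absurd hlt (not_lt.2 ?_)
    refine (hloc F hF x hx (ENNReal.ofReal (l / C)) fun r hr0 hr => ?_).trans_eq ?_
    · have h := lintegral_rpow_le_measure_univ_mul (volume.restrict (Metric.ball x r))
        hF.aemeasurable hp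
      rw [Measure.restrict_apply_univ, Real.volume_ball] at h
      have h2 := h.trans (mul_le_mul' le_rfl (hcon r hr0 hr))
      rw [ENNReal.ofReal_rpow_of_pos (by positivity), ← ENNReal.ofReal_mul (by positivity)] at h2
      rw [← ENNReal.ofReal_mul hr0.le, ← ENNReal.rpow_le_rpow_iff hp0]
      refine h2.trans_eq ?_
      rw [ENNReal.ofReal_rpow_of_pos (by positivity)]
      congr 1
      rw [ha, Real.mul_rpow (by positivity) (by positivity),
        Real.mul_rpow (by positivity) (by positivity)]
      have : r ^ p = r ^ (p - 1) * r := by rw [← Real.rpow_add_one hr0.ne', sub_add_cancel]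
      rw [this]
      field_simp
    · rw [← ENNReal.ofReal_mul hC.le, mul_div_cancel₀ _ hC.ne']
  have hlp : l ^ p = 2 ^ (p - 1) * C ^ p * a := by
    rw [ha, Real.div_rpow hl.le hC.le]
    field_simp
  calc _ ≤ ENNReal.ofReal (2 ^ (p - 1) * C ^ p) * (ENNReal.ofReal a * powMeasure δ
        {x | 0 < x ∧ ∃ r, 0 < r ∧ r ≤ x / 20 ∧
          ENNReal.ofReal (a * r) < ∫⁻ y in Metric.ball x r, F y ^ p}) := by
        rw [← mul_assoc, ← ENNReal.ofReal_mul (by positivity), ← hlp]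
        gcongr
    _ ≤ ENNReal.ofReal (2 ^ (p - 1) * C ^ p) * (ENNReal.ofReal (8 * (2 ^ |δ| * 2 ^ |δ|)) *
          ∫⁻ x, F x ^ p ∂(powMeasure δ)) := by
        gcongr ENNReal.ofReal _ * ?_
        exact ofReal_mul_powMeasure_local_le δ (hF.pow_const p) ha0
    _ = _ := by
        rw [← mul_assoc, ← ENNReal.ofReal_mul (by positivity)]
        rfl

lemma HasWeakTypePow.add {S₁ S₂ : (ℝ → ℝ≥0∞) → ℝ → ℝ≥0∞} {p δ : ℝ}
    (h₁ : HasWeakTypePow S₁ p δ) (h₂ : HasWeakTypePow S₂ p δ) :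
    HasWeakTypePow (fun F x => S₁ F x + S₂ F x) p δ := by
  obtain ⟨C₁, h₁⟩ := h₁
  obtain ⟨C₂, h₂⟩ := h₂
  refine ⟨Real.toNNReal (2 ^ p) * (C₁ + C₂), fun F hF l hl => ?_⟩
  have hl2 : 0 < l / 2 := by positivity
  have hlp : l ^ p = 2 ^ p * (l / 2) ^ p := by
    rw [← Real.mul_rpow (by norm_num) hl2.le, mul_div_cancel₀ _ two_ne_zero]
  have hsub : {x | 0 < x ∧ ENNReal.ofReal l < S₁ F x + S₂ F x} ⊆
      {x | 0 < x ∧ ENNReal.ofReal (l / 2) < S₁ F x} ∪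
        {x | 0 < x ∧ ENNReal.ofReal (l / 2) < S₂ F x} := by
    rintro x ⟨hx, h⟩
    by_contra hcon
    simp only [mem_union, mem_ofPred_eq, hx, true_and, not_or, not_lt] at hcon
    refine absurd h (not_lt.2 ((add_le_add hcon.1 hcon.2).trans_eq ?_))
    rw [← ENNReal.ofReal_add hl2.le hl2.le, add_halves]
  calc _ ≤ ENNReal.ofReal (l ^ p) * (powMeasure δ {x | 0 < x ∧ ENNReal.ofReal (l / 2) < S₁ F x} +
        powMeasure δ {x | 0 < x ∧ ENNReal.ofReal (l / 2) < S₂ F x}) := by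
        gcongr
        exact (measure_mono hsub).trans (measure_union_le _ _)
    _ = ENNReal.ofReal (2 ^ p) *
        (ENNReal.ofReal ((l / 2) ^ p) * powMeasure δ {x | 0 < x ∧ ENNReal.ofReal (l / 2) < S₁ F x} +
        ENNReal.ofReal ((l / 2) ^ p) *
          powMeasure δ {x | 0 < x ∧ ENNReal.ofReal (l / 2) < S₂ F x}) := by
        rw [hlp, ENNReal.ofReal_mul (by positivity)]
        ring
    _ ≤ ENNReal.ofReal (2 ^ p) * (C₁ * ∫⁻ x, F x ^ p ∂(powMeasure δ) +
          C₂ * ∫⁻ x, F x ^ p ∂(powMeasure δ)) := by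
        gcongr ENNReal.ofReal _ * (?_ + ?_)
        · exact h₁ F hF _ hl2
        · exact h₂ F hF _ hl2
    _ = _ := by
        rw [← add_mul, ← mul_assoc, ENNReal.coe_mul, ENNReal.coe_add]
        rfl

lemma HasWeakTypePow.const_mul {S : (ℝ → ℝ≥0∞) → ℝ → ℝ≥0∞} {p δ : ℝ}
    (h : HasWeakTypePow S p δ) {c : ℝ} (hc : 0 < c) :
    HasWeakTypePow (fun F x => ENNReal.ofReal c * S F x) p δ := by
  obtain ⟨C, h⟩ := h
  refine ⟨Real.toNNReal (c ^ p) * C, fun F hF l hl => ?_⟩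
  have hlc : 0 < l / c := by positivity
  have hlp : l ^ p = c ^ p * (l / c) ^ p := by
    rw [← Real.mul_rpow hc.le hlc.le, mul_div_cancel₀ _ hc.ne']
  have hsub : {x | 0 < x ∧ ENNReal.ofReal l < ENNReal.ofReal c * S F x} ⊆
      {x | 0 < x ∧ ENNReal.ofReal (l / c) < S F x} := by
    rintro x ⟨hx, h⟩
    refine ⟨hx, ?_⟩
    by_contra! hcon
    refine absurd h (not_lt.2 ((mul_le_mul' le_rfl hcon).trans_eq ?_))
    rw [← ENNReal.ofReal_mul hc.le, mul_div_cancel₀ _ hc.ne']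
  calc _ ≤ ENNReal.ofReal (l ^ p) * powMeasure δ {x | 0 < x ∧ ENNReal.ofReal (l / c) < S F x} := by
        gcongr
    _ = ENNReal.ofReal (c ^ p) * (ENNReal.ofReal ((l / c) ^ p) *
        powMeasure δ {x | 0 < x ∧ ENNReal.ofReal (l / c) < S F x}) := by
        rw [hlp, ENNReal.ofReal_mul (by positivity), mul_assoc]
    _ ≤ ENNReal.ofReal (c ^ p) * (C * ∫⁻ x, F x ^ p ∂(powMeasure δ)) := by
        gcongr ENNReal.ofReal _ * ?_
        exact h F hF _ hlc
    _ = _ := by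
        rw [← mul_assoc, ENNReal.coe_mul]
        rfl

lemma lintegral_etaMeasure (ν : ℝ) (g : ℝ → ℝ≥0∞) :
    ∫⁻ y, g y ∂(etaMeasure ν) = ∫⁻ y in Ioi 0, ENNReal.ofReal (y ^ (2 * ν + 1)) * g y := by
  unfold etaMeasure
  rw [lintegral_withDensity_eq_lintegral_mul_non_measurable _ (by fun_prop)
    (Filter.Eventually.of_forall fun x => ENNReal.ofReal_lt_top)]
  rfl

lemma lintegral_enorm_Wexo_mul {ν : ℝ} (hν : ν < 1) (f : ℝ → ℝ) {t x : ℝ} (ht : 0 < t)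
    (hx : 0 < x) :
    ∫⁻ y, ‖Wexo ν t x y * f y‖ₑ ∂(etaMeasure ν) =
      ∫⁻ y in Ioi 0, ENNReal.ofReal (heatDensity (-ν) t x y) * ENNReal.ofReal |f y| := by
  rw [lintegral_etaMeasure]
  refine setLIntegral_congr_fun measurableSet_Ioi fun y hy => ?_
  have hy0 : 0 < y := hy
  have h0 := heatDensity_nonneg (α := -ν) (by linarith) ht hx hy0
  have hpow : 0 < y ^ (2 * ν + 1) := by positivity
  rw [Real.enorm_eq_ofReal_abs, ← ENNReal.ofReal_mul hpow.le, ← ENNReal.ofReal_mul h0,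
    ← Wexo_mul_rpow ν t hx hy0, abs_mul, abs_of_nonneg (a := Wexo ν t x y)]
  · ring_nf
  · rw [← Wexo_mul_rpow ν t hx hy0] at h0
    exact nonneg_of_mul_nonneg_left h0 hpow

lemma ofReal_abs_WexoInt_le {ν : ℝ} (hν : ν < 1) (f : ℝ → ℝ) {t x : ℝ} (ht : 0 < t)
    (hx : 0 < x) :
    ENNReal.ofReal |WexoInt ν t f x| ≤
      ∫⁻ y in Ioi 0, ENNReal.ofReal (heatDensity (-ν) t x y) * ENNReal.ofReal |f y| := by
  rw [← Real.enorm_eq_ofReal_abs, ← lintegral_enorm_Wexo_mul hν f ht hx]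
  exact enorm_integral_le_lintegral_enorm _

lemma exists_lintegral_heatDensity_le {α : ℝ} (hα : -1 < α) : ∃ C : ℝ, 0 < C ∧
    ∀ F : ℝ → ℝ≥0∞, ∀ t x : ℝ, 0 < t → 0 < x →
      ∫⁻ y in Ioi 0, ENNReal.ofReal (heatDensity α t x y) * F y ≤
        ENNReal.ofReal C * hardyLow F x + ENNReal.ofReal C * localMax F x +
          ∫⁻ y in Ici (x + x / 20), ENNReal.ofReal (heatDensity α t x y) * F y := by
  obtain ⟨C₁, hC₁, h₁⟩ := exists_heatDensity_le_of_lt hα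
  obtain ⟨C₂, hC₂, h₂⟩ := exists_heatDensity_local_le hα
  refine ⟨max C₁ C₂, by positivity, fun F t x ht hx => ?_⟩
  have hcov : Ioi (0 : ℝ) ⊆ (Ioc 0 (x - x / 20) ∪ Metric.ball x (x / 20)) ∪ Ici (x + x / 20) := by
    intro y hy
    rcases le_or_gt y (x - x / 20) with h | h
    · exact Or.inl (Or.inl ⟨hy, h⟩)
    · rcases le_or_gt (x + x / 20) y with h' | h'
      · exact Or.inr h'
      · refine Or.inl (Or.inr ?_)
        rw [Metric.mem_ball, Real.dist_eq, abs_lt]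
        constructor <;> linarith
  refine (lintegral_mono_set hcov).trans ((lintegral_union_le _ _ _).trans ?_)
  gcongr
  refine (lintegral_union_le _ _ _).trans ?_
  gcongr
  · rw [hardyLow, ← lintegral_const_mul' _ _ ENNReal.ofReal_ne_top]
    calc _ ≤ ∫⁻ y in Ioc 0 (x - x / 20), ENNReal.ofReal (max C₁ C₂) *
          ((if y < x then ENNReal.ofReal (x ^ (-2 : ℝ) * y) else 0) * F y) := by
          refine setLIntegral_mono' measurableSet_Ioc fun y hy => ?_
          have hy0 : 0 < y := hy.1
          rw [if_pos (by linarith [hy.2]), ← mul_assoc, ← ENNReal.ofReal_mul (by positivity)]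
          gcongr
          refine (h₁ t x y ht hx hy0 hy.2).trans ?_
          gcongr
          exact le_max_left _ _
      _ ≤ _ := lintegral_mono_set Ioc_subset_Ioi_self
  · refine le_trans ?_ (mul_le_mul' le_rfl (le_iSup₂ (f := fun t (_ : t ∈ Ioi (0 : ℝ)) =>
      ∫⁻ y in Metric.ball x (x / 20),
        ENNReal.ofReal (t ^ (-(1 / 2) : ℝ) * Real.exp (-(y - x) ^ 2 / (4 * t)) + x⁻¹) * F y) t ht))
    rw [← lintegral_const_mul' _ _ ENNReal.ofReal_ne_top]
    refine setLIntegral_mono' measurableSet_ball fun y hy => ?_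
    rw [Metric.mem_ball, Real.dist_eq] at hy
    rw [← mul_assoc, ← ENNReal.ofReal_mul (by positivity)]
    gcongr
    refine (h₂ t x y ht hx hy).trans ?_
    gcongr
    exact le_max_right _ _

/-- Weak type of the exotic maximal operator, given that of the Hardy-type part and of a majorant
of the part `y > x`. -/
lemma exists_WexoMax_weak_le {ν p δ : ℝ} (hν : ν < 1) {U : (ℝ → ℝ≥0∞) → ℝ → ℝ≥0∞} (hp : 1 ≤ p)
    (hlow : HasWeakTypePow hardyLow p δ) (hU : HasWeakTypePow U p δ) {C : ℝ} (hC : 0 < C)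
    (hle : ∀ F : ℝ → ℝ≥0∞, ∀ t x : ℝ, 0 < t → 0 < x →
      ∫⁻ y in Ici (x + x / 20), ENNReal.ofReal (heatDensity (-ν) t x y) * F y ≤
        ENNReal.ofReal C * U F x) :
    ∃ C : ℝ≥0, ∀ f : ℝ → ℝ, MemLpPow f p δ → ∀ l : ℝ, 0 < l →
      ENNReal.ofReal (l ^ p) * powMeasure δ {x | ENNReal.ofReal l < WexoMax ν f x} ≤
        C * ∫⁻ x, ENNReal.ofReal |f x| ^ p ∂(powMeasure δ) := by
  obtain ⟨C', hC', hker⟩ := exists_lintegral_heatDensity_le (α := -ν) (by linarith)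
  obtain ⟨K, hK⟩ := ((hlow.const_mul hC').add ((hasWeakTypePow_localMax hp δ).const_mul hC')).add
    (hU.const_mul hC)
  refine ⟨K, fun f hf l hl => ?_⟩
  set F : ℝ → ℝ≥0∞ := fun x => ENNReal.ofReal |hf.1.mk f x| with hF
  have hFm : Measurable F := by
    have := hf.1.measurable_mk
    simp only [hF, ← Real.enorm_eq_ofReal_abs]
    fun_prop
  have hae : ∀ᵐ x ∂(powMeasure δ), ENNReal.ofReal |f x| = F x := by
    filter_upwards [hf.1.ae_eq_mk] with x hx
    rw [hF, hx]
  have hae' : ∀ᵐ x ∂(volume.restrict (Ioi (0 : ℝ))), ENNReal.ofReal |f x| = F x := by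
    unfold powMeasure at hae
    rw [ae_withDensity_iff (by fun_prop)] at hae
    filter_upwards [hae, ae_restrict_mem measurableSet_Ioi] with x hx hx0
    refine hx ?_
    have hx0' : 0 < x := hx0
    have : 0 < x ^ δ := by positivity
    simpa using this
  have hnull : powMeasure δ (Iic 0) = 0 := by
    refine withDensity_absolutelyContinuous _ _ ?_
    rw [Measure.restrict_apply measurableSet_Iic, Iic_inter_Ioi]
    simp
  have hsub : {x | ENNReal.ofReal l < WexoMax ν f x} ⊆ Iic 0 ∪ {x | 0 < x ∧ ENNReal.ofReal l <
      ENNReal.ofReal C' * hardyLow F x + ENNReal.ofReal C' * localMax F x +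
        ENNReal.ofReal C * U F x} := by
    intro x hx
    rcases le_or_gt x 0 with h | h
    · exact Or.inl h
    · refine Or.inr ⟨h, lt_of_lt_of_le hx (iSup₂_le fun t ht => ?_)⟩
      refine (ofReal_abs_WexoInt_le hν f ht h).trans ?_
      rw [lintegral_congr_ae (g := fun y => ENNReal.ofReal (heatDensity (-ν) t x y) * F y)
        (by filter_upwards [hae'] with y hy; rw [hy])]
      refine (hker F t x ht h).trans ?_
      gcongr
      exact hle F t x ht h
  rw [lintegral_congr_ae (g := fun x => F x ^ p) (by filter_upwards [hae] with y hy; rw [hy])]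
  refine le_trans ?_ (hK F hFm l hl)
  refine mul_le_mul' le_rfl ((measure_mono hsub).trans ((measure_union_le _ _).trans ?_))
  rw [hnull, zero_add]

lemma exists_WexoMax_weak_of_conditions {ν p δ : ℝ} (hν0 : ν ≠ 0) (hν : ν < 1) (hp : 1 ≤ p)
    (h1 : 2 * ν * p - 1 ≤ δ) (h2 : p = 1 → δ ≤ 2 * p - 1) (h3 : p ≠ 1 → δ < 2 * p - 1) :
    ∃ C : ℝ≥0, ∀ f : ℝ → ℝ, MemLpPow f p δ → ∀ l : ℝ, 0 < l →
      ENNReal.ofReal (l ^ p) * powMeasure δ {x | ENNReal.ofReal l < WexoMax ν f x} ≤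
        C * ∫⁻ x, ENNReal.ofReal |f x| ^ p ∂(powMeasure δ) := by
  have hlow : HasWeakTypePow hardyLow p δ := by
    rcases lt_or_ge δ (2 * p - 1) with h | h
    · exact hasWeakTypePow_hardyLow hp h
    · have hp1 : p = 1 := by
        by_contra hp1
        linarith [h3 hp1]
      subst hp1
      have : δ = 1 := by linarith [h2 rfl]
      subst this
      exact hasWeakTypePow_hardyLow_one
  have hα : -1 < -ν := by linarith
  rcases h1.eq_or_lt with h | h
  · obtain ⟨C, c, hC, hc, hker⟩ := exists_heatDensity_le_of_gt hα
    refine exists_WexoMax_weak_le hν hp hlow (hasWeakTypePow_gaussUp hα (neg_ne_zero.2 hν0) hc hp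
      (by linarith)) hC fun F t x ht hx => ?_
    refine le_trans ?_ (mul_le_mul' le_rfl (le_iSup₂ (f := fun t (_ : t ∈ Ioi (0 : ℝ)) =>
      ∫⁻ y in Ioi 0, ENNReal.ofReal (t ^ (-1 - -ν) * x ^ (2 * -ν) * y *
        Real.exp (-(c * (y ^ 2 / t)))) * F y) t ht))
    rw [← lintegral_const_mul' _ _ ENNReal.ofReal_ne_top]
    refine le_trans (setLIntegral_mono' measurableSet_Ici fun y hy => ?_)
      (lintegral_mono_set (s := Ici (x + x / 20)) fun y hy => ?_)
    · rw [← mul_assoc, ← ENNReal.ofReal_mul hC.le]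
      gcongr
      exact (hker t x y ht hx hy).trans_eq (by ring)
    · have : x + x / 20 ≤ y := hy
      have : 0 < y := by linarith
      exact this
  · obtain ⟨C, hC, hker⟩ := exists_heatDensity_le_of_gt' hα
    refine exists_WexoMax_weak_le hν hp hlow (hasWeakTypePow_hardyUp (α := -ν) hp
      (by linarith)) hC fun F t x ht hx => ?_
    rw [hardyUp, ← lintegral_const_mul' _ _ ENNReal.ofReal_ne_top]
    refine le_trans (setLIntegral_mono' measurableSet_Ici fun y hy => ?_)
      (lintegral_mono_set (s := Ici (x + x / 20)) fun y hy => ?_)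
    · have hy' : x + x / 20 ≤ y := hy
      rw [if_pos (by linarith), ← mul_assoc, ← ENNReal.ofReal_mul hC.le]
      gcongr
      exact hker t x y ht hx hy
    · have : x + x / 20 ≤ y := hy
      have : 0 < y := by linarith
      exact this

lemma aestronglyMeasurable_Wexo_mul {ν : ℝ} (hν : ν < 1) {f : ℝ → ℝ} (hf : Measurable f)
    {t x : ℝ} (ht : 0 < t) (hx : 0 < x) :
    AEStronglyMeasurable (fun y => Wexo ν t x y * f y) (etaMeasure ν) := by
  have hb := measurable_besselI (-ν) (by linarith)
  refine AEStronglyMeasurable.mono_ac (withDensity_absolutelyContinuous _ _)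
    (AEStronglyMeasurable.congr (f := fun y => ((x * y) ^ (-(2 * ν)) * ((2 * t)⁻¹ *
      (x * y) ^ (- -ν) * Real.exp (-(x ^ 2 + y ^ 2) / (4 * t)) *
        (Ioi 0).indicator (besselI (-ν)) (x * y / (2 * t)))) * f y) ?_ ?_)
  · exact Measurable.aestronglyMeasurable (by fun_prop)
  · filter_upwards [ae_restrict_mem measurableSet_Ioi] with y hy
    have hy0 : 0 < y := hy
    have : x * y / (2 * t) ∈ Ioi (0 : ℝ) := by
      simp only [mem_Ioi]
      positivity
    simp only [Wexo, Wcls, indicator_of_mem this]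

lemma ofReal_abs_WexoInt_eq {ν : ℝ} (hν : ν < 1) {f : ℝ → ℝ} (hf : Measurable f)
    (hf0 : ∀ y, 0 ≤ f y) {t x : ℝ} (ht : 0 < t) (hx : 0 < x)
    (hfin : ∫⁻ y in Ioi 0, ENNReal.ofReal (heatDensity (-ν) t x y) * ENNReal.ofReal |f y| < ⊤) :
    ENNReal.ofReal |WexoInt ν t f x| =
      ∫⁻ y in Ioi 0, ENNReal.ofReal (heatDensity (-ν) t x y) * ENNReal.ofReal |f y| := by
  have hm := aestronglyMeasurable_Wexo_mul hν hf ht hx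
  rw [← lintegral_enorm_Wexo_mul hν f ht hx] at hfin ⊢
  have hi : Integrable (fun y => Wexo ν t x y * f y) (etaMeasure ν) := ⟨hm, hfin⟩
  have h0 : 0 ≤ᵐ[etaMeasure ν] fun y => Wexo ν t x y * f y := by
    refine (withDensity_absolutelyContinuous _ _).ae_le ?_
    filter_upwards [ae_restrict_mem measurableSet_Ioi] with y hy
    have hy0 : 0 < y := hy
    have h := heatDensity_nonneg (α := -ν) (by linarith) ht hx hy0
    rw [← Wexo_mul_rpow ν t hx hy0] at h
    exact mul_nonneg (nonneg_of_mul_nonneg_left h (by positivity)) (hf0 y)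
  rw [WexoInt, abs_of_nonneg (integral_nonneg_of_ae h0), ofReal_integral_eq_lintegral_ofReal hi h0]
  refine lintegral_congr_ae ?_
  filter_upwards [h0] with y hy
  rw [Real.enorm_eq_ofReal_abs, abs_of_nonneg hy]

lemma exists_le_WexoMax {ν : ℝ} (hν : ν < 1) : ∃ c : ℝ, 0 < c ∧ ∀ f : ℝ → ℝ, Measurable f →
    (∀ y, 0 ≤ f y) → ∀ B : ℝ, (∀ y, f y ≤ B) → (∀ y, y ∉ Ioo 0 2 → f y = 0) →
    ∀ x, 0 < x → x ≤ 2 →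
      ENNReal.ofReal (c * x ^ (-(2 * ν))) * ∫⁻ y in Ioi 0, ENNReal.ofReal (y * f y) ≤
        WexoMax ν f x := by
  have hα : -1 < -ν := by linarith
  have hΓ : 0 < Real.Gamma (-ν + 1) := Real.Gamma_pos_of_pos (by linarith)
  set c₀ : ℝ := 2 ^ (-1 - 2 * -ν) / Real.Gamma (-ν + 1) with hc₀
  have hc₀pos : 0 < c₀ := by positivity
  refine ⟨c₀ * Real.exp (-2), by positivity, fun f hf hf0 B hB hsupp x hx hx2 => ?_⟩
  have hB0 : 0 ≤ B := (hf0 0).trans (hB 0)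
  obtain ⟨C, hC, hle⟩ := exists_heatDensity_le hα
  refine le_trans ?_ (le_iSup₂ (f := fun t (_ : t ∈ Ioi (0 : ℝ)) =>
    ENNReal.ofReal |WexoInt ν t f x|) 1 (mem_Ioi.2 one_pos))
  have hfin : ∫⁻ y in Ioi 0, ENNReal.ofReal (heatDensity (-ν) 1 x y) * ENNReal.ofReal |f y| < ⊤ := by
    calc _ ≤ ∫⁻ y in Ioi 0, (Ioo (0 : ℝ) 2).indicator
          (fun _ => ENNReal.ofReal (C * (x ^ (2 * -ν) * 2) * (1 + x) * B)) y := by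
          refine setLIntegral_mono' measurableSet_Ioi fun y hy => ?_
          by_cases hy2 : y ∈ Ioo (0 : ℝ) 2
          · have hy0 : 0 < y := hy2.1
            have hy3 : y ≤ 2 := hy2.2.le
            rw [indicator_of_mem hy2, ← ENNReal.ofReal_mul (heatDensity_nonneg hα one_pos hx hy0),
              abs_of_nonneg (hf0 y)]
            refine ENNReal.ofReal_le_ofReal ?_
            have h := hle 1 x y one_pos hx hy0
            have he : Real.exp (-(x - y) ^ 2 / (4 * 1)) ≤ 1 := by
              rw [Real.exp_le_one_iff]
              have := sq_nonneg (x - y)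
              linarith
            have h1 : heatDensity (-ν) 1 x y ≤ C * (x ^ (2 * -ν) * 2) * (1 + x) := by
              refine h.trans ?_
              rw [Real.one_rpow, one_mul]
              calc _ ≤ C * (x ^ (2 * -ν) * 2) * (1 + x * 2 / (2 * 1)) * 1 := by gcongr
                _ = _ := by ring
            exact mul_le_mul h1 (hB y) (hf0 y) (by positivity)
          · rw [indicator_of_notMem hy2, hsupp y hy2]
            simp
      _ ≤ ∫⁻ y, (Ioo (0 : ℝ) 2).indicator
          (fun _ => ENNReal.ofReal (C * (x ^ (2 * -ν) * 2) * (1 + x) * B)) y :=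
          setLIntegral_le_lintegral _ _
      _ < ⊤ := by
          rw [lintegral_indicator measurableSet_Ioo, setLIntegral_const, Real.volume_Ioo]
          exact ENNReal.mul_lt_top ENNReal.ofReal_lt_top ENNReal.ofReal_lt_top
  rw [ofReal_abs_WexoInt_eq hν hf hf0 one_pos hx hfin,
    ← lintegral_const_mul' _ _ ENNReal.ofReal_ne_top]
  refine setLIntegral_mono' measurableSet_Ioi fun y hy => ?_
  have hy0 : 0 < y := hy
  by_cases hy2 : y ∈ Ioo (0 : ℝ) 2
  · rw [← ENNReal.ofReal_mul (by positivity),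
      ← ENNReal.ofReal_mul (heatDensity_nonneg hα one_pos hx hy0), abs_of_nonneg (hf0 y)]
    refine ENNReal.ofReal_le_ofReal ?_
    rw [← mul_assoc]
    refine mul_le_mul_of_nonneg_right (le_trans ?_ (heatDensity_ge hα one_pos hx hy0)) (hf0 y)
    rw [Real.one_rpow, one_mul, mul_one, ← hc₀, show 2 * -ν = -(2 * ν) by ring]
    have : Real.exp (-2) ≤ Real.exp (-(x ^ 2 + y ^ 2) / 4) := by
      refine Real.exp_le_exp.2 ?_
      nlinarith [hy2.2]
    calc _ = c₀ * (x ^ (-(2 * ν)) * y) * Real.exp (-2) := by ring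
      _ ≤ _ := by gcongr
  · rw [hsupp y hy2]
    simp

lemma ofReal_le_powMeasure_Ioo (δ : ℝ) {a : ℝ} (ha : 0 < a) :
    ENNReal.ofReal ((2 ^ |δ|)⁻¹ * a ^ (δ + 1)) ≤ powMeasure δ (Ioo a (2 * a)) := by
  have hs0 : Ioo a (2 * a) ⊆ Ioi 0 := fun y hy => ha.trans hy.1
  have h := setLIntegral_powMeasure δ (measurableSet_Ioo (a := a) (b := 2 * a)) hs0 1
  simp only [Pi.one_apply, lintegral_const, Measure.restrict_apply_univ, one_mul, mul_one] at h
  rw [h]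
  calc _ = ∫⁻ y in Ioo a (2 * a), ENNReal.ofReal ((2 ^ |δ|)⁻¹ * a ^ δ) := by
        rw [setLIntegral_const, Real.volume_Ioo, ← ENNReal.ofReal_mul (by positivity),
          Real.rpow_add_one ha.ne']
        ring_nf
    _ ≤ _ := by
        refine setLIntegral_mono' measurableSet_Ioo fun y hy => ENNReal.ofReal_le_ofReal ?_
        have hy0 : 0 < y := hs0 hy
        have := rpow_le_two_rpow_abs (r := a / y) (a := δ)
          (by rw [le_div_iff₀ hy0]; linarith [hy.2]) (by rw [div_le_iff₀ hy0]; linarith [hy.1])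
        rw [Real.div_rpow ha.le hy0.le, div_le_iff₀ (by positivity)] at this
        rwa [inv_mul_le_iff₀ (by positivity)]

/-- The maximal operator tested on the functions `y ↦ y ^ s` on `(a, b)`. -/
lemma exists_weak_test {ν p δ : ℝ} (hν : ν < 1) (hp : 1 ≤ p)
    (h : ∃ C : ℝ≥0, ∀ f : ℝ → ℝ, MemLpPow f p δ → ∀ l : ℝ, 0 < l →
      ENNReal.ofReal (l ^ p) * powMeasure δ {x | ENNReal.ofReal l < WexoMax ν f x} ≤
        C * ∫⁻ x, ENNReal.ofReal |f x| ^ p ∂(powMeasure δ)) :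
    ∃ c : ℝ, 0 < c ∧ ∃ K : ℝ≥0, ∀ s a b : ℝ, 0 < a → b ≤ 2 → ∀ r : ℝ, 0 < r → r ≤ 1 →
      ∀ M : ℝ, 0 < M → ENNReal.ofReal M ≤ ∫⁻ y in Ioo a b, ENNReal.ofReal (y ^ (s + 1)) →
      ENNReal.ofReal (c * (M ^ p * r ^ (-(2 * ν * p) + δ + 1))) ≤
        K * ∫⁻ y in Ioo a b, ENNReal.ofReal (y ^ (δ + s * p)) := by
  obtain ⟨K, hK⟩ := h
  obtain ⟨c, hc, hmax⟩ := exists_le_WexoMax hν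
  have hp0 : 0 < p := by linarith
  set q : ℝ := c * (2 ^ |2 * ν|)⁻¹ / 2 with hq
  have hq0 : 0 < q := by positivity
  refine ⟨q ^ p * (2 ^ |δ|)⁻¹, by positivity, K, fun s a b ha hb r hr hr1 M hM hMle => ?_⟩
  have hab0 : Ioo a b ⊆ Ioi 0 := fun y hy => ha.trans hy.1
  set f : ℝ → ℝ := (Ioo a b).indicator fun y => y ^ s with hf
  have hfm : Measurable f := Measurable.indicator (by fun_prop) measurableSet_Ioo
  have hf0 : ∀ y, 0 ≤ f y := fun y => indicator_nonneg
    (fun y hy => Real.rpow_nonneg (hab0 hy).le s) y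
  have hcont : ∀ e : ℝ, ContinuousOn (fun y : ℝ => y ^ e) (Icc a b) := fun e =>
    continuousOn_id.rpow_const fun y hy => Or.inl (ha.trans_le hy.1).ne'
  obtain ⟨B, hB⟩ := isCompact_Icc.exists_bound_of_continuousOn (hcont s)
  have hnorm : ∫⁻ x, ENNReal.ofReal |f x| ^ p ∂(powMeasure δ) =
      ∫⁻ y in Ioo a b, ENNReal.ofReal (y ^ (δ + s * p)) := by
    have e : (fun x => ENNReal.ofReal |f x| ^ p) =
        (Ioo a b).indicator fun y => ENNReal.ofReal |y ^ s| ^ p := by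
      ext x
      by_cases hx : x ∈ Ioo a b
      · rw [indicator_of_mem hx, hf, indicator_of_mem hx]
      · rw [indicator_of_notMem hx, hf, indicator_of_notMem hx]
        simp [hp0]
    rw [e, lintegral_indicator measurableSet_Ioo, setLIntegral_powMeasure δ measurableSet_Ioo hab0]
    refine setLIntegral_congr_fun measurableSet_Ioo fun y hy => ?_
    have hy0 : 0 < y := hab0 hy
    rw [abs_of_pos (by positivity), ENNReal.ofReal_rpow_of_pos (by positivity),
      ← Real.rpow_mul hy0.le, ofReal_rpow_mul_rpow hy0]
  have hmem : MemLpPow f p δ := by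
    refine ⟨hfm.aemeasurable, ?_⟩
    rw [hnorm]
    exact (((hcont _).integrableOn_Icc).mono_set Ioo_subset_Icc_self).lintegral_lt_top
  have hint : ∫⁻ y in Ioi 0, ENNReal.ofReal (y * f y) =
      ∫⁻ y in Ioo a b, ENNReal.ofReal (y ^ (s + 1)) := by
    have e : (fun y => ENNReal.ofReal (y * f y)) =
        (Ioo a b).indicator fun y => ENNReal.ofReal (y ^ (s + 1)) := by
      ext y
      by_cases hy : y ∈ Ioo a b
      · rw [indicator_of_mem hy, hf, indicator_of_mem hy, Real.rpow_add_one (hab0 hy).ne', mul_comm]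
      · rw [indicator_of_notMem hy, hf, indicator_of_notMem hy]
        simp
    rw [e, lintegral_indicator measurableSet_Ioo, Measure.restrict_restrict measurableSet_Ioo,
      inter_eq_left.2 hab0]
  set l : ℝ := q * r ^ (-(2 * ν)) * M with hl
  have hl0 : 0 < l := by positivity
  have hsub : Ioo r (2 * r) ⊆ {x | ENNReal.ofReal l < WexoMax ν f x} := by
    intro x hx
    have hx0 : 0 < x := hr.trans hx.1
    have h1 := hmax f hfm hf0 (max B 0) (fun y => by
      by_cases hy : y ∈ Ioo a b
      · rw [hf, indicator_of_mem hy]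
        exact (le_abs_self _).trans ((hB y (Ioo_subset_Icc_self hy)).trans (le_max_left _ _))
      · rw [hf, indicator_of_notMem hy]
        exact le_max_right _ _)
      (fun y hy => indicator_of_notMem (fun hy' => hy ⟨hab0 hy', hy'.2.trans_le hb⟩) _)
      x hx0 (by linarith [hx.2])
    rw [hint] at h1
    refine lt_of_lt_of_le ?_ ((mul_le_mul' le_rfl hMle).trans h1)
    rw [← ENNReal.ofReal_mul (by positivity)]
    refine (ENNReal.ofReal_lt_ofReal_iff (by positivity)).2 ?_
    have := rpow_le_two_rpow_abs (r := r / x) (a := -(2 * ν))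
      (by rw [le_div_iff₀ hx0]; linarith [hx.2]) (by rw [div_le_iff₀ hx0]; linarith [hx.1])
    rw [Real.div_rpow hr.le hx0.le, div_le_iff₀ (by positivity), abs_neg] at this
    calc l < 2 * l := by linarith
      _ = c * ((2 ^ |2 * ν|)⁻¹ * r ^ (-(2 * ν))) * M := by rw [hl, hq]; ring
      _ ≤ _ := by
        gcongr
        rwa [inv_mul_le_iff₀ (by positivity)]
  have h2 := hK f hmem l hl0
  rw [hnorm] at h2
  refine le_trans ?_ h2
  refine le_trans ?_ (mul_le_mul' le_rfl ((ofReal_le_powMeasure_Ioo δ hr).trans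
    (measure_mono hsub)))
  rw [← ENNReal.ofReal_mul (by positivity)]
  refine (congrArg ENNReal.ofReal ?_).le
  rw [hl, Real.mul_rpow (by positivity) hM.le, Real.mul_rpow hq0.le (by positivity),
    ← Real.rpow_mul hr.le, show -(2 * ν * p) + δ + 1 = -(2 * ν) * p + (δ + 1) by ring,
    Real.rpow_add hr]
  ring

lemma setLIntegral_inv {L : ℝ} (hL : 0 < L) :
    ∫⁻ y in Ioo (Real.exp (-L)) 1, ENNReal.ofReal (y ^ (-1 : ℝ)) = ENNReal.ofReal L := by
  have hle : Real.exp (-L) ≤ 1 := Real.exp_le_one_iff.2 (by linarith)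
  have he := Real.exp_pos (-L)
  have hi : IntegrableOn (fun y : ℝ => y ^ (-1 : ℝ)) (Ioo (Real.exp (-L)) 1) :=
    (ContinuousOn.integrableOn_Icc (continuousOn_id.rpow_const fun y hy =>
      Or.inl (he.trans_le hy.1).ne')).mono_set Ioo_subset_Icc_self
  rw [← ofReal_integral_eq_lintegral_ofReal hi]
  · simp_rw [Real.rpow_neg_one]
    rw [← integral_Ioc_eq_integral_Ioo, ← intervalIntegral.integral_of_le hle,
      integral_inv_of_pos he one_pos, one_div, ← Real.exp_neg, neg_neg, Real.log_exp]
  · filter_upwards [ae_restrict_mem measurableSet_Ioo] with y hy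
    exact Real.rpow_nonneg (he.trans hy.1).le _

lemma conditions_of_exists_WexoMax_weak {ν p δ : ℝ} (hν : ν < 1) (hp : 1 ≤ p)
    (h : ∃ C : ℝ≥0, ∀ f : ℝ → ℝ, MemLpPow f p δ → ∀ l : ℝ, 0 < l →
      ENNReal.ofReal (l ^ p) * powMeasure δ {x | ENNReal.ofReal l < WexoMax ν f x} ≤
        C * ∫⁻ x, ENNReal.ofReal |f x| ^ p ∂(powMeasure δ)) :
    2 * ν * p - 1 ≤ δ ∧ (p = 1 → δ ≤ 2 * p - 1) ∧ (p ≠ 1 → δ < 2 * p - 1) := by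
  obtain ⟨c, hc, K, htest⟩ := exists_weak_test hν hp h
  have hlog : ∀ L : ℝ, 0 < L → ENNReal.ofReal (c * L ^ p) ≤
      K * ∫⁻ y in Ioo (Real.exp (-L)) 1, ENNReal.ofReal (y ^ (δ - 2 * p)) := by
    intro L hL
    have := htest (-2) (Real.exp (-L)) 1 (Real.exp_pos _) one_le_two 1 one_pos le_rfl L hL
      (by rw [← setLIntegral_inv hL]; norm_num)
    rw [Real.one_rpow, mul_one] at this
    convert this using 7
    ring
  refine ⟨?_, ?_, ?_⟩
  · by_contra! hδ
    set e := -(2 * ν * p) + δ + 1 with he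
    have he0 : e < 0 := by linarith
    set N := ∫⁻ y in Ioo (1 : ℝ) 2, ENNReal.ofReal (y ^ (δ + 0 * p)) with hN
    have hNfin : N < ⊤ := ((ContinuousOn.integrableOn_Icc (continuousOn_id.rpow_const fun y hy =>
      Or.inl (one_pos.trans_le hy.1).ne')).mono_set Ioo_subset_Icc_self).lintegral_lt_top
    have hKN : (K : ℝ≥0∞) * N ≠ ⊤ := (ENNReal.mul_lt_top ENNReal.coe_lt_top hNfin).ne
    set R := (K * N).toReal / c with hR
    have hR0 : 0 ≤ R := by positivity
    have h1 := htest 0 1 2 one_pos le_rfl ((R + 1) ^ e⁻¹) (by positivity)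
      (Real.rpow_le_one_of_one_le_of_nonpos (by linarith) (inv_nonpos.2 he0.le)) 1 one_pos (by
        calc ENNReal.ofReal 1 = ∫⁻ y in Ioo (1 : ℝ) 2, 1 := by
              rw [setLIntegral_const, Real.volume_Ioo]; norm_num
          _ ≤ _ := by
              refine setLIntegral_mono' measurableSet_Ioo fun y hy => ?_
              rw [zero_add, Real.rpow_one, ENNReal.one_le_ofReal]
              exact hy.1.le)
    rw [← Real.rpow_mul (by positivity), inv_mul_cancel₀ he0.ne, Real.rpow_one, ← hN,
      Real.one_rpow, one_mul, ENNReal.ofReal_le_iff_le_toReal hKN, ← le_div_iff₀' hc, ← hR] at h1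
    linarith
  · rintro rfl
    by_contra! hδ
    have h1 : 0 < δ - 1 := by linarith
    have hfin : ∀ L : ℝ, 0 < L → c * L ≤ K * (1 / (δ - 1)) := by
      intro L hL
      have := (hlog L hL).trans (mul_le_mul' le_rfl (lintegral_mono_set
        (Ioo_subset_Ioo_left (Real.exp_pos (-L)).le)))
      rw [lintegral_Ioo_rpow (by linarith) zero_le_one, Real.rpow_one, Real.one_rpow,
        show δ - 2 * 1 + 1 = δ - 1 by ring, ← ENNReal.ofReal_coe_nnreal,
        ← ENNReal.ofReal_mul K.coe_nonneg, ENNReal.ofReal_le_ofReal_iff (by positivity)] at this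
      exact this
    have h2 := hfin ((K * (1 / (δ - 1)) + 1) / c) (by positivity)
    rw [mul_div_cancel₀ _ hc.ne'] at h2
    linarith
  · intro hp1
    by_contra! hδ
    have hp2 : 0 < p - 1 := by
      rcases hp.eq_or_lt with h | h
      · exact absurd h.symm hp1
      · linarith
    have hfin : ∀ L : ℝ, 0 < L → c * L ^ (p - 1) ≤ K := by
      intro L hL
      have h1 : ∫⁻ y in Ioo (Real.exp (-L)) 1, ENNReal.ofReal (y ^ (δ - 2 * p)) ≤
          ENNReal.ofReal L := by
        rw [← setLIntegral_inv hL]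
        refine setLIntegral_mono' measurableSet_Ioo fun y hy => ENNReal.ofReal_le_ofReal ?_
        exact Real.rpow_le_rpow_of_exponent_ge ((Real.exp_pos _).trans hy.1) hy.2.le (by linarith)
      have := (hlog L hL).trans (mul_le_mul' le_rfl h1)
      rw [← ENNReal.ofReal_coe_nnreal, ← ENNReal.ofReal_mul K.coe_nonneg,
        ENNReal.ofReal_le_ofReal_iff (by positivity)] at this
      rw [← sub_add_cancel p 1, Real.rpow_add_one hL.ne', ← mul_assoc] at this
      exact le_of_mul_le_mul_right this hL
    have h2 := hfin (((K + 1) / c) ^ (p - 1)⁻¹) (by positivity)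
    rw [← Real.rpow_mul (by positivity), inv_mul_cancel₀ hp2.ne', Real.rpow_one,
      mul_div_cancel₀ _ hc.ne'] at h2
    linarith

theorem stmt13 (ν δ p : ℝ) (hν0 : ν ≠ 0) (hν1 : ν < 1) (hp : 1 ≤ p) :
    (∃ C : ℝ≥0, ∀ f : ℝ → ℝ, MemLpPow f p δ → ∀ l : ℝ, 0 < l →
        ENNReal.ofReal (l ^ p) * powMeasure δ {x | ENNReal.ofReal l < WexoMax ν f x} ≤
          C * ∫⁻ x, ENNReal.ofReal |f x| ^ p ∂(powMeasure δ)) ↔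
      (2 * ν * p - 1 ≤ δ ∧
        (p = 1 → δ ≤ 2 * p - 1) ∧ (p ≠ 1 → δ < 2 * p - 1)) := by
  exact ⟨conditions_of_exists_WexoMax_weak hν1 hp, fun ⟨h1, h2, h3⟩ =>
    exists_WexoMax_weak_of_conditions hν0 hν1 hp h1 h2 h3⟩

end
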